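/- arXiv:2203.02328 — 2 statements merged into one kernel-verified Lean document; each statement's English description precedes it below -/
import Mathlib

section
/- Let d, n and k_1, …, k_d be positive integers with k_1 + ⋯ + k_d = n. There is a constant C = C(n), depending only on n, such that for every field F and every finitely supported function S : F^n → ℝ_{≥0} with ∑_{p ∈ F^n} S(p)^d = 1, there exist, for each 1 ≤ j ≤ d, functions s_{k_j} : F^n × Gr(k_j, F^n) → ℝ_{≥0} with s_{k_j}(p, V) = 0 whenever S(p) = 0, satisfying: (i) for every p ∈ F^n and every tuple of subspaces V_1 ∈ Gr(k_1, F^n), …, V_d ∈ Gr(k_d, F^n) with V_1 + ⋯ + V_d = F^n, one has S(p)^d ≤ C · ∏_{j=1}^d s_{k_j}(p, V_j); and (ii) for every 1 ≤ j ≤ d and every affine k_j-plane π ⊆ F^n, the (finite) sum ∑_{p ∈ π ∩ supp S} s_{k_j}(p, e(π)) is at most 1. -/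
namespace DiscreteFactorisation

open MvPolynomial Finset

section Polynomials

variable {F : Type*} [Field F] {σ ρ : Type*}

/-- The Taylor shift `g(X) ↦ g(X + y)`. -/
noncomputable def taylor (y : σ → F) : MvPolynomial σ F →ₐ[F] MvPolynomial σ F :=
  aeval fun i => X i + C (y i)

lemma taylor_taylor (y z : σ → F) (g : MvPolynomial σ F) :
    taylor y (taylor z g) = taylor (y + z) g := by
  have : (taylor y).comp (taylor z) = taylor (y + z) := by
    ext i : 1
    simp [taylor, algebraMap_eq, add_assoc]
  exact DFunLike.congr_fun this g

lemma taylor_zero (g : MvPolynomial σ F) : taylor 0 g = g := by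
  have : taylor (0 : σ → F) = AlgHom.id F _ := by
    ext i : 1
    simp [taylor]
  exact DFunLike.congr_fun this g

lemma taylor_neg_taylor (y : σ → F) (g : MvPolynomial σ F) : taylor (-y) (taylor y g) = g := by
  rw [taylor_taylor, neg_add_cancel, taylor_zero]

lemma taylor_taylor_neg (y : σ → F) (g : MvPolynomial σ F) : taylor y (taylor (-y) g) = g := by
  rw [taylor_taylor, add_neg_cancel, taylor_zero]

lemma totalDegree_aeval_le (f : σ → MvPolynomial ρ F) (hf : ∀ i, (f i).totalDegree ≤ 1)
    (g : MvPolynomial σ F) : (aeval f g).totalDegree ≤ g.totalDegree := by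
  rw [aeval_def, eval₂_eq]
  refine totalDegree_finsetSum_le fun e he => ?_
  refine (totalDegree_mul _ _).trans ?_
  rw [algebraMap_eq, totalDegree_C, zero_add]
  refine (totalDegree_finsetProd _ _).trans (le_trans ?_ (le_totalDegree he))
  refine Finset.sum_le_sum fun i _ => (totalDegree_pow _ _).trans ?_
  simpa using Nat.mul_le_mul_left (e i) (hf i)

lemma totalDegree_taylor_le (y : σ → F) (g : MvPolynomial σ F) :
    (taylor y g).totalDegree ≤ g.totalDegree :=
  totalDegree_aeval_le _ (fun i => (totalDegree_add _ _).trans (by simp)) g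

/-- Polynomials vanishing to order at least `m` at `y`. -/
noncomputable def vanishing (y : σ → F) (m : ℕ) : Submodule F (MvPolynomial σ F) :=
  ((idealOfVars σ F ^ m).restrictScalars F).comap (taylor y).toLinearMap

lemma mem_vanishing {y : σ → F} {m : ℕ} {g : MvPolynomial σ F} :
    g ∈ vanishing y m ↔ taylor y g ∈ idealOfVars σ F ^ m := Iff.rfl

lemma mem_vanishing_iff_coeff {y : σ → F} {m : ℕ} {g : MvPolynomial σ F} :
    g ∈ vanishing y m ↔ ∀ e : σ →₀ ℕ, e.degree < m → (taylor y g).coeff e = 0 := by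
  rw [mem_vanishing, mem_pow_idealOfVars_iff']

lemma eq_zero_of_mem_vanishing {y : σ → F} {m : ℕ} {g : MvPolynomial σ F}
    (hg : g ∈ vanishing y m) (hd : g.totalDegree < m) : g = 0 := by
  have h0 : taylor y g = 0 := by
    ext e
    by_cases he : e.degree < m
    · exact mem_vanishing_iff_coeff.1 hg e he
    · refine coeff_eq_zero_of_totalDegree_lt ?_
      rw [← Finsupp.degree_apply]
      have := totalDegree_taylor_le y g
      omega
  rw [← taylor_neg_taylor y g, h0, map_zero]

lemma mul_mem_vanishing {y : σ → F} {m : ℕ} {l g : MvPolynomial σ F}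
    (hl : l ∈ vanishing y 1) (hg : g ∈ vanishing y m) : l * g ∈ vanishing y (m + 1) := by
  rw [mem_vanishing] at *
  rw [map_mul, pow_succ']
  exact Ideal.mul_mem_mul (by simpa using hl) hg

lemma mul_mem_vanishing' {y : σ → F} {m : ℕ} {l g : MvPolynomial σ F}
    (hg : g ∈ vanishing y m) : l * g ∈ vanishing y m := by
  rw [mem_vanishing] at *
  rw [map_mul]
  exact Ideal.mul_mem_left _ _ hg

/-- Multiplication by `l` with `l - c` vanishing at `y`, `c ≠ 0`, does not raise the order. -/
lemma mem_vanishing_of_mul {y : σ → F} {m : ℕ} {l g : MvPolynomial σ F} {c : F} (hc : c ≠ 0)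
    (hl : l - C c ∈ vanishing y 1) (hg : g ∈ vanishing y m) (h : l * g ∈ vanishing y (m + 1)) :
    g ∈ vanishing y (m + 1) := by
  have h1 := sub_mem h (mul_mem_vanishing hl hg)
  have h2 : l * g - (l - C c) * g = c • g := by
    rw [smul_eq_C_mul]; ring
  rw [h2] at h1
  exact (Submodule.smul_mem_iff _ hc).1 h1

lemma exists_separating {p q : σ → F} (hpq : p ≠ q) :
    ∃ (l : MvPolynomial σ F) (c : F), l.totalDegree ≤ 1 ∧ c ≠ 0 ∧ l ∈ vanishing p 1 ∧
      l - C c ∈ vanishing q 1 := by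
  obtain ⟨i, hi⟩ := Function.ne_iff.1 hpq
  have key : ∀ y : σ → F, X i - C (y i) ∈ vanishing y 1 := fun y => by
    rw [mem_vanishing, pow_one]
    simpa [taylor, algebraMap_eq] using Ideal.subset_span (Set.mem_range_self i)
  refine ⟨X i - C (p i), q i - p i, ?_, sub_ne_zero.2 (Ne.symm hi), key p, ?_⟩
  · exact (totalDegree_sub _ _).trans (by simp)
  · convert! key q using 1
    simp

section LinSubst

variable [Fintype ρ] [DecidableEq ρ]

/-- Substitution of a linear map. -/
noncomputable def linSubst (M : (ρ → F) →ₗ[F] (σ → F)) :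
    MvPolynomial σ F →ₐ[F] MvPolynomial ρ F :=
  aeval fun i => ∑ b, C (M (Pi.single b 1) i) * X b

lemma apply_eq_sum_single (M : (ρ → F) →ₗ[F] (σ → F)) (z : ρ → F) (i : σ) :
    M z i = ∑ b, M (Pi.single b 1) i * z b := by
  conv_lhs => rw [pi_eq_sum_univ' z]
  simp [Finset.sum_apply, mul_comm, map_sum, Pi.single]

lemma taylor_linSubst (M : (ρ → F) →ₗ[F] (σ → F)) (z : ρ → F) (g : MvPolynomial σ F) :
    taylor z (linSubst M g) = linSubst M (taylor (M z) g) := by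
  have : (taylor z).comp (linSubst M) = (linSubst M).comp (taylor (M z)) := by
    ext i : 1
    simp [taylor, linSubst, algebraMap_eq, apply_eq_sum_single M z i, mul_add, Finset.sum_add_distrib]
  exact DFunLike.congr_fun this g

lemma totalDegree_linSubst_le (M : (ρ → F) →ₗ[F] (σ → F)) (g : MvPolynomial σ F) :
    (linSubst M g).totalDegree ≤ g.totalDegree := by
  refine totalDegree_aeval_le _ (fun i => totalDegree_finsetSum_le fun b _ => ?_) g
  exact (totalDegree_mul _ _).trans (by simp)

lemma linSubst_mem_pow (M : (ρ → F) →ₗ[F] (σ → F)) {m : ℕ} {g : MvPolynomial σ F}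
    (hg : g ∈ idealOfVars σ F ^ m) : linSubst M g ∈ idealOfVars ρ F ^ m := by
  have h1 : (idealOfVars σ F).map (linSubst M) ≤ idealOfVars ρ F := by
    rw [Ideal.map_span, Ideal.span_le]
    rintro _ ⟨_, ⟨i, rfl⟩, rfl⟩
    simp only [linSubst, aeval_X]
    exact sum_mem fun b _ => Ideal.mul_mem_left _ _ (Ideal.subset_span (Set.mem_range_self b))
  have h2 := Ideal.mem_map_of_mem (linSubst M) hg
  rw [Ideal.map_pow] at h2
  exact Ideal.pow_right_mono h1 m h2

lemma linSubst_linSubst [Fintype σ] [DecidableEq σ] (M : (ρ → F) →ₗ[F] (σ → F))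
    (M' : (σ → F) →ₗ[F] (ρ → F)) (h : M ∘ₗ M' = LinearMap.id) (g : MvPolynomial σ F) :
    linSubst M' (linSubst M g) = g := by
  have : (linSubst M').comp (linSubst M) = AlgHom.id F _ := by
    ext i : 1
    simp only [linSubst, AlgHom.comp_apply, aeval_X, map_sum, map_mul, AlgHom.id_apply]
    simp only [← algebraMap_eq, AlgHom.commutes]
    simp_rw [Finset.mul_sum]
    rw [Finset.sum_comm]
    simp_rw [← mul_assoc, ← map_mul, ← Finset.sum_mul, ← map_sum, ← apply_eq_sum_single M]
    simp_rw [← LinearMap.comp_apply, h]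
    simp [Pi.single_apply, algebraMap_eq]
  exact DFunLike.congr_fun this g

end LinSubst

end Polynomials

section Slice

variable {F : Type*} [Field F] {ι : Type*} [DecidableEq ι] {α : ι → Type*}

/-- Regard a polynomial in blocks of variables as a polynomial with coefficients in the polynomials
in the `j`-th block. -/
noncomputable def toIter (j : ι) :
    MvPolynomial (Σ i, α i) F →ₐ[F] MvPolynomial (Σ i, α i) (MvPolynomial (α j) F) :=
  aeval fun b => if h : b.1 = j then C (X (h ▸ b.2)) else X b

/-- The coefficient, as a polynomial in the `j`-th block of variables, of the monomial with
exponent `e` in the other variables. -/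
noncomputable def slice (j : ι) (e : (Σ i, α i) →₀ ℕ) (g : MvPolynomial (Σ i, α i) F) :
    MvPolynomial (α j) F :=
  (toIter j g).coeff e

lemma toIter_monomial (j : ι) (e : (Σ i, α i) →₀ ℕ) (c : F) :
    toIter j (monomial e c) = monomial (e.filter (fun b => b.1 ≠ j)) (monomial (e.split j) c) := by
  have key : toIter (F := F) j (monomial e 1) =
      monomial (e.filter (fun b => b.1 ≠ j)) (monomial (e.split j) 1) := by
    induction e using Finsupp.induction_linear with
    | zero =>
      have : (0 : (Σ i, α i) →₀ ℕ).split j = 0 := by ext; simp [Finsupp.split_apply]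
      rw [this, Finsupp.filter_zero, monomial_zero', monomial_zero', monomial_zero']
      simp
    | add e e' h h' =>
      have : (e + e').split j = e.split j + e'.split j := by ext; simp [Finsupp.split_apply]
      rw [← one_mul (1 : F), ← monomial_mul, map_mul, h, h', monomial_mul, monomial_mul, this,
        Finsupp.filter_add]
    | single b m =>
      obtain ⟨i, a⟩ := b
      rw [← C_mul_X_pow_eq_monomial, map_mul, map_pow]
      by_cases h : i = j
      · subst h
        have h1 : (Finsupp.single (⟨i, a⟩ : Σ i, α i) m).split i = Finsupp.single a m := by
          classical
          ext; simp [Finsupp.split_apply, Finsupp.single_apply]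
        rw [h1, Finsupp.filter_single_of_neg _ (by simp), ← C_mul_X_pow_eq_monomial]
        simp [toIter, monomial_zero']
      · have h1 : (Finsupp.single (⟨i, a⟩ : Σ i, α i) m).split j = 0 := by
          classical
          ext; simp [Finsupp.split_apply, Finsupp.single_apply]; aesop
        rw [h1, Finsupp.filter_single_of_pos _ (by simpa using h)]
        simp [toIter, h, X_pow_eq_monomial]
  rw [← mul_one c, ← smul_eq_mul, ← smul_monomial, map_smul, key]
  simp [smul_monomial]

lemma eq_filter_add_mapDomain_iff (j : ι) (u e : (Σ i, α i) →₀ ℕ) (f : α j →₀ ℕ) :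
    u = e.filter (fun b => b.1 ≠ j) + f.mapDomain (Sigma.mk j) ↔
      u.filter (fun b => b.1 ≠ j) = e.filter (fun b => b.1 ≠ j) ∧ u.split j = f := by
  have hin : ∀ a, f.mapDomain (Sigma.mk j) ⟨j, a⟩ = f a := fun a =>
    Finsupp.mapDomain_apply sigma_mk_injective f a
  have hout : ∀ i a, i ≠ j → f.mapDomain (Sigma.mk j) ⟨i, a⟩ = 0 := fun i a hi =>
    Finsupp.mapDomain_of_notMem_range _ _ (by rintro ⟨x, hx⟩; exact hi (by cases hx; rfl))
  constructor
  · rintro rfl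
    constructor
    · ext ⟨i, a⟩
      by_cases hi : i = j
      · simp [hi]
      · simp [hi, hout i a hi]
    · ext a
      simp [Finsupp.split_apply, hin]
  · rintro ⟨h1, h2⟩
    ext ⟨i, a⟩
    by_cases hi : i = j
    · subst hi
      simp [hin, ← DFunLike.congr_fun h2 a, Finsupp.split_apply]
    · have := DFunLike.congr_fun h1 ⟨i, a⟩
      simp [hi] at this
      simp [hi, hout i a hi, this]

lemma coeff_slice (j : ι) (e : (Σ i, α i) →₀ ℕ) (g : MvPolynomial (Σ i, α i) F) (f : α j →₀ ℕ) :
    (slice j (e.filter (fun b => b.1 ≠ j)) g).coeff f =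
      g.coeff (e.filter (fun b => b.1 ≠ j) + f.mapDomain (Sigma.mk j)) := by
  classical
  induction g using MvPolynomial.induction_on' with
  | add p q hp hq => simp only [slice, map_add, coeff_add] at *; rw [hp, hq]
  | monomial u c =>
    rw [slice, toIter_monomial, coeff_monomial, coeff_monomial]
    have h := eq_filter_add_mapDomain_iff j u e f
    by_cases h1 : u.filter (fun b => b.1 ≠ j) = e.filter (fun b => b.1 ≠ j)
    · by_cases h2 : u.split j = f
      · rw [if_pos h1, if_pos (h.2 ⟨h1, h2⟩), coeff_monomial, if_pos h2]
      · rw [if_pos h1, if_neg (fun h' => h2 (h.1 h').2), coeff_monomial, if_neg h2]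
    · rw [if_neg h1, if_neg (fun h' => h1 (h.1 h').1), coeff_zero]

omit [DecidableEq ι] in
lemma degree_add_mapDomain (j : ι) (e : (Σ i, α i) →₀ ℕ) (f : α j →₀ ℕ) :
    (e + f.mapDomain (Sigma.mk j)).degree = e.degree + f.degree := by
  rw [map_add, Finsupp.degree_mapDomain]

lemma totalDegree_slice_le (j : ι) (e : (Σ i, α i) →₀ ℕ) (g : MvPolynomial (Σ i, α i) F) :
    (slice j (e.filter (fun b => b.1 ≠ j)) g).totalDegree ≤ g.totalDegree := by
  refine Finset.sup_le fun f hf => ?_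
  rw [mem_support_iff, coeff_slice, ← mem_support_iff] at hf
  refine le_trans ?_ (le_totalDegree hf)
  change f.degree ≤ Finsupp.degree _
  rw [degree_add_mapDomain]
  exact Nat.le_add_left _ _

lemma taylor_slice (j : ι) (e : (Σ i, α i) →₀ ℕ) (g : MvPolynomial (Σ i, α i) F) (z : α j → F) :
    taylor z (slice j e g) =
      slice j e (taylor (fun b => if h : b.1 = j then z (h ▸ b.2) else 0) g) := by
  have : ((mapAlgHom (taylor z)).restrictScalars F).comp (toIter j) =
      (toIter j).comp (taylor (fun b => if h : b.1 = j then z (h ▸ b.2) else 0)) := by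
    ext ⟨i, a⟩ : 1
    by_cases h : i = j
    · subst h
      simp [toIter, taylor, algebraMap_eq]
    · simp [toIter, taylor, h]
  have h := congrArg (coeff e) (DFunLike.congr_fun this g)
  simpa [slice, coeff_map] using h

end Slice

section RelativeDimension

variable {F : Type*} [Field F] {M M' : Type*} [AddCommGroup M] [Module F M] [AddCommGroup M']
  [Module F M']

open Module

lemma finrank_sub_le_finrank_sub (f : M →ₗ[F] M') {A B : Submodule F M} {A' B' : Submodule F M'}
    [FiniteDimensional F A] [FiniteDimensional F A'] (hBA : B ≤ A) (hBA' : B' ≤ A')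
    (hf : ∀ a ∈ A, f a ∈ A') (h : ∀ a ∈ A, f a ∈ B' → a ∈ B) :
    finrank F A - finrank F B ≤ finrank F A' - finrank F B' := by
  let φ : A →ₗ[F] M' ⧸ B' := B'.mkQ ∘ₗ f ∘ₗ A.subtype
  have h1 := LinearMap.finrank_range_add_finrank_ker φ
  have h2 : finrank F φ.ker ≤ finrank F B := by
    have : FiniteDimensional F B := Submodule.finiteDimensional_of_le hBA
    have hk : φ.ker ≤ B.comap A.subtype := fun a ha => by
      refine h a a.2 ?_
      simpa [φ] using ha
    refine (Submodule.finrank_mono hk).trans ?_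
    exact (Submodule.comapSubtypeEquivOfLe hBA).finrank_eq.le
  let ψ : A' →ₗ[F] M' ⧸ B' := B'.mkQ ∘ₗ A'.subtype
  have h3 := LinearMap.finrank_range_add_finrank_ker ψ
  have h4 : finrank F B' ≤ finrank F ψ.ker := by
    have hk : B'.comap A'.subtype ≤ ψ.ker := fun a ha => by simpa [ψ] using ha
    refine le_trans ?_ (Submodule.finrank_mono hk)
    exact (Submodule.comapSubtypeEquivOfLe hBA').finrank_eq.ge
  have h5 : finrank F φ.range ≤ finrank F ψ.range := by
    refine Submodule.finrank_mono ?_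
    rintro _ ⟨a, rfl⟩
    exact ⟨⟨f a, hf a a.2⟩, rfl⟩
  omega

lemma exists_finset_functionals {κ : Type*} (c : κ → M →ₗ[F] F) (W' : Submodule F M)
    (hc : ∀ w ∈ W', ∀ i, c i w = 0) (W : Submodule F M) [FiniteDimensional F W] (hW : W' ≤ W)
    (h : ∀ w ∈ W, (∀ i, c i w = 0) → w ∈ W') :
    ∃ I : Finset κ, #I ≤ finrank F W - finrank F W' ∧
      ∀ w ∈ W, (∀ i ∈ I, c i w = 0) → w ∈ W' := by
  classical
  induction hd : finrank F W using Nat.strong_induction_on generalizing W with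
  | _ D ih =>
    by_cases hWW : W ≤ W'
    · exact ⟨∅, by simp, fun w hw _ => hWW hw⟩
    obtain ⟨w, hw, hw'⟩ := Set.not_subset.1 hWW
    obtain ⟨i, hi⟩ : ∃ i, c i w ≠ 0 := by
      by_contra! hcon
      exact hw' (h w hw hcon)
    have hlt : W ⊓ (c i).ker < W := by
      refine lt_of_le_of_ne inf_le_left fun heq => hi ?_
      have : w ∈ W ⊓ (c i).ker := by rw [heq]; exact hw
      exact this.2
    have hle : W' ≤ W ⊓ (c i).ker := le_inf hW fun v hv => hc v hv i
    have hfin : FiniteDimensional F ↥(W ⊓ (c i).ker) :=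
      Submodule.finiteDimensional_of_le inf_le_left
    have hr := Submodule.finrank_lt_finrank_of_lt hlt
    have hr' := Submodule.finrank_mono hle
    obtain ⟨I, hI, hI'⟩ := ih _ (hd ▸ hr) (W ⊓ (c i).ker) hle (fun v hv => h v hv.1) rfl
    refine ⟨insert i I, (Finset.card_insert_le _ _).trans (by omega), fun v hv hv' => ?_⟩
    exact hI' v ⟨hv, hv' i (by simp)⟩ fun a ha => hv' a (by simp [ha])

end RelativeDimension

section Flag

open Module

variable {F : Type*} [Field F] {σ : Type*} {E : Type*} {m : ℕ}

/-- The time at which the condition of vanishing to order more than `r` at the `q`-th point is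
imposed, where `β q` is the delay of the `q`-th point. -/
def time (β : Fin m → ℕ) (q : Fin m) (r : ℕ) : ℕ := (r + β q) * m + q

lemma time_mod (β : Fin m → ℕ) (q : Fin m) (r : ℕ) : time β q r % m = q := by
  simp [time, Nat.mod_eq_of_lt q.2]

lemma time_injective {β : Fin m → ℕ} {q q' : Fin m} {r r' : ℕ}
    (h : time β q r = time β q' r') : q = q' ∧ r = r' := by
  have hq : q = q' := by
    ext
    rw [← time_mod β q r, h, time_mod]
  subst hq
  have hm : 0 < m := q.pos
  simp [time] at h
  omega

lemma time_lt_time {β : Fin m → ℕ} {q : Fin m} {r r' : ℕ} (h : r < r') :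
    time β q r < time β q r' := by
  have hm : 0 < m := q.pos
  have : r + β q < r' + β q := by omega
  have := (Nat.mul_lt_mul_right hm).2 this
  simp only [time]
  omega

variable (x : Fin m → E) (A : (σ → F) → E) (N : ℕ) (β : Fin m → ℕ)

/-- Polynomials of degree at most `N`, satisfying all the vanishing conditions imposed before
time `t` at those of the points `x` which are in the image of the parametrisation `A`. -/
noncomputable def flag (t : ℕ) : Submodule F (MvPolynomial σ F) where
  carrier := {g | g.totalDegree ≤ N ∧
    ∀ q r y, A y = x q → time β q r < t → g ∈ vanishing y (r + 1)}
  add_mem' := fun ha hb => ⟨(totalDegree_add _ _).trans (max_le ha.1 hb.1),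
    fun q r y h h' => add_mem (ha.2 q r y h h') (hb.2 q r y h h')⟩
  zero_mem' := ⟨by simp, fun _ _ _ _ _ => zero_mem _⟩
  smul_mem' := fun c g hg => ⟨(totalDegree_smul_le c g).trans hg.1,
    fun q r y h h' => Submodule.smul_mem _ c (hg.2 q r y h h')⟩

/-- The number of independent conditions contributed by the `q`-th point. -/
noncomputable def jump (q : Fin m) : ℕ :=
  ∑ r ∈ range (N + 1),
    (finrank F (flag x A N β (time β q r)) - finrank F (flag x A N β (time β q r + 1)))

variable {x A N β}

lemma flag_anti : Antitone (flag x A N β) :=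
  fun _ _ h _ hg => ⟨hg.1, fun q r y h1 h2 => hg.2 q r y h1 (h2.trans_le h)⟩

lemma flag_le (t : ℕ) : flag x A N β t ≤ restrictTotalDegree σ F N :=
  fun _ hg => (mem_restrictTotalDegree _ _ _).2 hg.1

lemma flag_zero : flag x A N β 0 = restrictTotalDegree σ F N :=
  le_antisymm (flag_le 0) fun _ hg =>
    ⟨(mem_restrictTotalDegree _ _ _).1 hg, fun _ _ _ _ h => absurd h (Nat.not_lt_zero _)⟩

instance [Finite σ] (t : ℕ) : FiniteDimensional F (flag x A N β t) :=
  Submodule.finiteDimensional_of_le (flag_le t)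

lemma mem_vanishing_of_mem_flag {q : Fin m} {r : ℕ} {y : σ → F} (hy : A y = x q)
    {g : MvPolynomial σ F} (hg : g ∈ flag x A N β (time β q r)) : g ∈ vanishing y r := by
  cases r with
  | zero => simp [mem_vanishing]
  | succ r => exact hg.2 q r y hy (time_lt_time (Nat.lt_succ_self r))

lemma mem_flag_time_succ (hA : Function.Injective A) {q : Fin m} {y : σ → F} (hy : A y = x q)
    {r : ℕ} {g : MvPolynomial σ F} : g ∈ flag x A N β (time β q r + 1) ↔
      g ∈ flag x A N β (time β q r) ∧ g ∈ vanishing y (r + 1) := by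
  refine ⟨fun h => ⟨flag_anti (Nat.le_succ _) h, h.2 q r y hy (Nat.lt_succ_self _)⟩,
    fun h => ⟨h.1.1, fun q' r' y' hy' ht => ?_⟩⟩
  rcases Nat.lt_succ_iff_lt_or_eq.1 ht with ht | ht
  · exact h.1.2 q' r' y' hy' ht
  · obtain ⟨rfl, rfl⟩ := time_injective ht
    rw [hA (hy'.trans hy.symm)]
    exact h.2

lemma flag_succ_of_ne {t : ℕ} (ht : ∀ q r, time β q r ≠ t) :
    flag x A N β (t + 1) = flag x A N β t :=
  le_antisymm (flag_anti (Nat.le_succ t)) fun _ hg => ⟨hg.1, fun q r y hy h =>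
    hg.2 q r y hy (lt_of_le_of_ne (Nat.lt_succ_iff.1 h) (ht q r))⟩

lemma flag_eq_bot {q : Fin m} {y : σ → F} (hy : A y = x q) {t : ℕ} (ht : time β q N < t) :
    flag x A N β t = ⊥ :=
  (Submodule.eq_bot_iff _).2 fun _ hg =>
    eq_zero_of_mem_vanishing (hg.2 q N y hy ht) (Nat.lt_succ_of_le hg.1)

variable [Finite σ]

lemma sum_range_finrank_flag (T : ℕ) :
    ∑ t ∈ range T, (finrank F (flag x A N β t) - finrank F (flag x A N β (t + 1))) =
      finrank F (restrictTotalDegree σ F N) - finrank F (flag x A N β T) := by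
  induction T with
  | zero => rw [flag_zero]; simp
  | succ T ih =>
    have h1 : finrank F (flag x A N β (T + 1)) ≤ finrank F (flag x A N β T) :=
      Submodule.finrank_mono (flag_anti (Nat.le_succ T))
    have h2 : finrank F (flag x A N β T) ≤ finrank F (restrictTotalDegree σ F N) :=
      Submodule.finrank_mono (flag_le T)
    rw [Finset.sum_range_succ, ih]
    omega

omit [Finite σ] in
lemma sum_jump_eq (s : Finset (Fin m)) : ∑ q ∈ s, jump x A N β q =
    ∑ t ∈ (s ×ˢ range (N + 1)).image (fun a => time β a.1 a.2),
      (finrank F (flag x A N β t) - finrank F (flag x A N β (t + 1))) := by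
  rw [Finset.sum_image, Finset.sum_product]
  · rfl
  · rintro ⟨q, r⟩ _ ⟨q', r'⟩ _ h
    obtain ⟨rfl, rfl⟩ := time_injective h
    rfl

lemma sum_jump_le (s : Finset (Fin m)) :
    ∑ q ∈ s, jump x A N β q ≤ finrank F (restrictTotalDegree σ F N) := by
  rw [sum_jump_eq]
  obtain ⟨T, hT⟩ := Finset.exists_nat_subset_range
    ((s ×ˢ range (N + 1)).image (fun a => time β a.1 a.2))
  refine (Finset.sum_le_sum_of_subset hT).trans ?_
  rw [sum_range_finrank_flag]
  exact Nat.sub_le _ _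

lemma sum_jump [NeZero m] (hA : Function.Surjective A) :
    ∑ q, jump x A N β q = finrank F (restrictTotalDegree σ F N) := by
  rw [sum_jump_eq]
  obtain ⟨T, hT⟩ := Finset.exists_nat_subset_range
    ((univ ×ˢ range (N + 1)).image (fun a : Fin m × ℕ => time β a.1 a.2))
  obtain ⟨y, hy⟩ := hA (x 0)
  rw [Finset.sum_subset (hT.trans (Finset.range_subset_range.2
    (le_max_left T (time β 0 N + 1)))), sum_range_finrank_flag,
    flag_eq_bot hy (Nat.lt_of_succ_le (le_max_right T _))]
  · simp
  · intro t _ ht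
    rw [tsub_eq_zero_iff_le]
    by_cases h : ∃ q r, time β q r = t
    · obtain ⟨q, r, rfl⟩ := h
      have hr : N < r := by
        by_contra! hr
        exact ht (Finset.mem_image.2 ⟨(q, r), by simp; omega, rfl⟩)
      obtain ⟨z, hz⟩ := hA (x q)
      rw [flag_eq_bot hz (time_lt_time hr)]
      simp
    · push Not at h
      rw [flag_succ_of_ne h]

lemma exists_jump_basis (hA : Function.Injective A) {q : Fin m} {y : σ → F} (hy : A y = x q) :
    ∃ I : Finset (σ →₀ ℕ), #I ≤ jump x A N β q ∧
      ∀ r, ∀ g ∈ flag x A N β (time β q r),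
        (∀ e ∈ I, e.degree = r → (taylor y g).coeff e = 0) → g ∈ vanishing y (r + 1) := by
  classical
  have h (r : ℕ) : ∃ I : Finset {e : σ →₀ ℕ // e.degree = r},
      #I ≤ finrank F (flag x A N β (time β q r)) - finrank F (flag x A N β (time β q r + 1)) ∧
      ∀ g ∈ flag x A N β (time β q r), (∀ e ∈ I, (taylor y g).coeff e = 0) →
        g ∈ flag x A N β (time β q r + 1) := by
    refine exists_finset_functionals (fun e : {e : σ →₀ ℕ // e.degree = r} =>
      lcoeff F e.1 ∘ₗ (taylor y).toLinearMap) _ ?_ _ (flag_anti (Nat.le_succ _)) ?_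
    · intro g hg e
      rw [mem_flag_time_succ hA hy, mem_vanishing_iff_coeff] at hg
      exact hg.2 e (by have := e.2; omega)
    · intro g hg h
      rw [mem_flag_time_succ hA hy, mem_vanishing_iff_coeff]
      refine ⟨hg, fun e he => ?_⟩
      rcases Nat.lt_succ_iff_lt_or_eq.1 he with he | he
      · exact mem_vanishing_iff_coeff.1 (mem_vanishing_of_mem_flag hy hg) e he
      · exact h ⟨e, he⟩
  choose I hI hI' using h
  refine ⟨(range (N + 1)).biUnion fun r => (I r).map (Function.Embedding.subtype _), ?_, ?_⟩
  · refine Finset.card_biUnion_le.trans (Finset.sum_le_sum fun r _ => ?_)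
    rw [Finset.card_map]
    exact hI r
  · intro r g hg h
    by_cases hr : r ≤ N
    · refine ((mem_flag_time_succ hA hy).1 (hI' r g hg fun e he => h e ?_ e.2)).2
      simp only [Finset.mem_biUnion, Finset.mem_map]
      exact ⟨r, by simp; omega, e, he, rfl⟩
    · rw [flag_eq_bot hy (time_lt_time (not_le.1 hr))] at hg
      rw [(Submodule.mem_bot F).1 hg]
      exact zero_mem _

end Flag

section Ambient

open Module

variable {F : Type*} [Field F] {σ : Type*} [Finite σ] {m : ℕ} {x : Fin m → σ → F} {N : ℕ}
  {β : Fin m → ℕ}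

lemma jump_le_jump_of_map {N' : ℕ} {β' : Fin m → ℕ} {q : Fin m} (hN : N ≤ N')
    (f : MvPolynomial σ F →ₗ[F] MvPolynomial σ F)
    (hf : ∀ r, ∀ g ∈ flag x id N β (time β q r), f g ∈ flag x id N' β' (time β' q r))
    (h : ∀ r, ∀ g ∈ flag x id N β (time β q r), f g ∈ vanishing (x q) (r + 1) →
      g ∈ vanishing (x q) (r + 1)) :
    jump x id N β q ≤ jump x id N' β' q := by
  have hinj : Function.Injective (id : (σ → F) → σ → F) := Function.injective_id
  have hx : id (x q) = x q := rfl
  refine le_trans (Finset.sum_le_sum fun r _ => ?_)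
    (Finset.sum_le_sum_of_subset (Finset.range_subset_range.2 (Nat.succ_le_succ hN)))
  refine finrank_sub_le_finrank_sub f (flag_anti (Nat.le_succ _)) (flag_anti (Nat.le_succ _))
    (hf r) fun g hg hg' => ?_
  rw [mem_flag_time_succ hinj hx] at hg' ⊢
  exact ⟨hg, h r g hg hg'.2⟩

lemma time_update_lt {p q q' : Fin m} (hq : q ≠ p) {r r' : ℕ}
    (h : time (β + Pi.single p 1) q' r' < time (β + Pi.single p 1) q r) :
    time β q' r' < time β q r := by
  have h1 : time (β + Pi.single p 1) q r = time β q r := by simp [time, hq]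
  have h2 : time β q' r' ≤ time (β + Pi.single p 1) q' r' := by
    simp only [time, Pi.add_apply]
    gcongr
    omega
  omega

/-- Delaying a point does not decrease the contribution of the other points. -/
lemma jump_le_jump_delay {p q : Fin m} (hq : q ≠ p) :
    jump x id N β q ≤ jump x id N (β + Pi.single p 1) q :=
  jump_le_jump_of_map le_rfl LinearMap.id
    (fun _ _ hg => ⟨hg.1, fun q' r' y hy ht => hg.2 q' r' y hy (time_update_lt hq ht)⟩)
    (fun _ _ _ h => h)

lemma jump_le_jump_succ (q : Fin m) : jump x id N β q ≤ jump x id (N + 1) β q :=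
  jump_le_jump_of_map (Nat.le_succ N) LinearMap.id
    (fun _ _ hg => ⟨hg.1.trans (Nat.le_succ N), hg.2⟩) (fun _ _ _ h => h)

lemma jump_delay_le_jump_succ (hx : Function.Injective x) {p q : Fin m} (hq : q ≠ p) :
    jump x id N (β + Pi.single p 1) q ≤ jump x id (N + 1) β q := by
  obtain ⟨l, c, hl, hc, hp, hl'⟩ := exists_separating (hx.ne hq.symm)
  refine jump_le_jump_of_map (Nat.le_succ N) (LinearMap.mulLeft F l) (fun r g hg => ⟨?_, ?_⟩) ?_
  · have := hg.1
    exact (totalDegree_mul _ _).trans (by omega)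
  · intro q' r' y hy ht
    rw [LinearMap.mulLeft_apply]
    have ht' : time (β + Pi.single p 1) q r = time β q r := by simp [time, hq]
    by_cases hq' : q' = p
    · subst hq'
      obtain rfl : y = x q' := hy
      cases r' with
      | zero => simpa [mul_comm] using mul_mem_vanishing' hp
      | succ r' =>
        refine mul_mem_vanishing hp (hg.2 q' r' _ rfl ?_)
        rw [ht']
        convert! ht using 1
        simp only [time, Pi.add_apply, Pi.single_eq_same]
        ring
    · refine mul_mem_vanishing' (hg.2 q' r' y hy ?_)
      rw [ht']
      simpa [time, hq'] using ht
  · intro r g hg h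
    exact mem_vanishing_of_mul hc hl' (mem_vanishing_of_mem_flag rfl hg) h

/-- Delaying a point by one step changes its contribution only by a lower order term. -/
lemma jump_succ_le_jump_delay (hx : Function.Injective x) (p : Fin m) :
    jump x id (N + 1) β p ≤ jump x id (N + 1) (β + Pi.single p 1) p +
      (finrank F (restrictTotalDegree σ F (N + 1)) - finrank F (restrictTotalDegree σ F N)) := by
  have : NeZero m := ⟨p.pos.ne'⟩
  have hs : Function.Surjective (id : (σ → F) → σ → F) := Function.surjective_id
  have h1 := sum_jump (x := x) (N := N + 1) (β := β) hs
  have h2 := sum_jump (x := x) (N := N) (β := β + Pi.single p 1) hs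
  have h3 := sum_jump (x := x) (N := N + 1) (β := β + Pi.single p 1) hs
  rw [← Finset.add_sum_erase _ _ (mem_univ p)] at h1 h2 h3
  have h4 : ∑ q ∈ univ.erase p, jump x id N (β + Pi.single p 1) q ≤
      ∑ q ∈ univ.erase p, jump x id (N + 1) β q :=
    Finset.sum_le_sum fun q hq => jump_delay_le_jump_succ hx (Finset.ne_of_mem_erase hq)
  have h5 := jump_le_jump_succ (x := x) (N := N) (β := β + Pi.single p 1) p
  omega

omit [Finite σ] in
lemma jump_eq_zero {p q : Fin m} (hp : N < β p) (hq : β q = 0) : jump x id N β p = 0 := by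
  refine Finset.sum_eq_zero fun r _ => ?_
  rw [flag_eq_bot (q := q) (y := x q) rfl]
  · simp
  · have h1 : (N + 1) * m ≤ (r + β p) * m := Nat.mul_le_mul_right m (by omega)
    have := q.2
    simp only [time, hq]
    linarith [Nat.zero_le (p : ℕ)]

/-- The delays can be chosen so that the contributions are at most prescribed targets. -/
lemma exists_delay (hx : Function.Injective x) (a : Fin m → ℕ) (ha : ∀ q, 0 < a q)
    (hsum : finrank F (restrictTotalDegree σ F (N + 1)) < ∑ q, a q) :
    ∃ β : Fin m → ℕ, ∀ q, jump x id (N + 1) β q ≤ a q +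
      (finrank F (restrictTotalDegree σ F (N + 1)) - finrank F (restrictTotalDegree σ F N)) := by
  let S : Set (Fin m → ℕ) := {β | ∀ q, 0 < β q → a q ≤ jump x id (N + 1) β q}
  have hm : NeZero m := ⟨by rintro rfl; simp at hsum⟩
  have hS : S.Finite := by
    refine (Set.finite_Iic fun _ => N + 1).subset fun β hβ p => ?_
    obtain ⟨q, hq⟩ : ∃ q, β q = 0 := by
      by_contra! hcon
      refine absurd (Finset.sum_le_sum fun q (_ : q ∈ univ) => hβ q (Nat.pos_of_ne_zero (hcon q))) ?_
      rw [sum_jump Function.surjective_id]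
      exact not_le.2 hsum
    by_contra! hp
    have h1 := hβ p (by simp at hp; omega)
    rw [jump_eq_zero hp hq] at h1
    exact absurd (ha p) (by omega)
  obtain ⟨β, hβ, hmax⟩ := hS.exists_maximalFor id S ⟨0, by simp [S]⟩
  refine ⟨β, fun p => ?_⟩
  by_contra! hp
  have hmem : β + Pi.single p 1 ∈ S := by
    intro q hq
    by_cases hqp : q = p
    · subst hqp
      have := jump_succ_le_jump_delay (N := N) (β := β) hx q
      omega
    · exact (hβ q (by simpa [hqp] using hq)).trans (jump_le_jump_delay hqp)
  have := hmax hmem (by intro q; simp) p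
  simp at this

end Ambient

section Tensor

open Module

variable {F : Type*} [Field F] {σ : Type*} {m : ℕ} {x : Fin m → σ → F} {N : ℕ}
  {β : Fin m → ℕ} {ι : Type*} [Fintype ι] [DecidableEq ι] {α : ι → Type*} [∀ i, Fintype (α i)]
  [∀ i, DecidableEq (α i)]

lemma time_add (q : Fin m) (r s : ℕ) : time β q (r + s) = time β q r + s * m := by
  simp only [time]
  ring

/-- The linear map from the product of the blocks given by linear maps on the blocks. -/
noncomputable def blockSum (L : ∀ i, (α i → F) →ₗ[F] (σ → F)) :
    ((Σ i, α i) → F) →ₗ[F] (σ → F) :=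
  ∑ i, L i ∘ₗ LinearMap.funLeft F F (Sigma.mk i)

omit [∀ i, DecidableEq (α i)] [∀ i, Fintype (α i)] in
lemma blockSum_dite (L : ∀ i, (α i → F) →ₗ[F] (σ → F)) (j : ι) (z : α j → F) :
    blockSum L (fun b => if h : b.1 = j then z (h ▸ b.2) else 0) = L j z := by
  simp only [blockSum, LinearMap.sum_apply, LinearMap.comp_apply]
  rw [Finset.sum_eq_single j]
  · congr 1
    ext a
    simp [LinearMap.funLeft_apply]
  · intro i _ hi
    convert! (L i).map_zero using 2
    ext a
    simp [LinearMap.funLeft_apply, hi]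
  · simp

variable {L : ∀ i, (α i → F) →ₗ[F] (σ → F)} {A : ∀ i, (α i → F) → (σ → F)} {q : Fin m}
  {y : ∀ i, α i → F}

lemma slice_mem_flag (hA : ∀ i z, A i z = x q + L i (z - y i)) {r : ℕ} {g : MvPolynomial σ F}
    {e : (Σ i, α i) →₀ ℕ} {i : ι}
    (hg : g ∈ flag x id N β (time β q (r + (e.filter (fun b => b.1 ≠ i)).degree))) :
    taylor (-y i) (slice i (e.filter (fun b => b.1 ≠ i))
      (linSubst (blockSum L) (taylor (x q) g))) ∈ flag x (A i) N β (time β q r) := by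
  refine ⟨?_, fun q' r' z hz ht => ?_⟩
  · exact (totalDegree_taylor_le _ _).trans <| (totalDegree_slice_le _ _ _).trans <|
      (totalDegree_linSubst_le _ _).trans <| (totalDegree_taylor_le _ _).trans hg.1
  · rw [mem_vanishing_iff_coeff]
    intro f hf
    rw [taylor_taylor, taylor_slice, taylor_linSubst, taylor_taylor, blockSum_dite, coeff_slice]
    have hz' : L i (z + -y i) + x q = x q' := by
      rw [← hz, hA, add_comm, sub_eq_add_neg]
    rw [hz']
    have hv := hg.2 q' (r' + (e.filter (fun b => b.1 ≠ i)).degree) (x q') rfl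
      (by rw [time_add, time_add]; omega)
    refine (mem_pow_idealOfVars_iff' _ _).1 (linSubst_mem_pow (blockSum L) (mem_vanishing.1 hv)) _ ?_
    rw [degree_add_mapDomain]
    omega

lemma coeff_eq_zero_of_blocks (hA : ∀ i z, A i z = x q + L i (z - y i))
    {I : ∀ i, Finset (α i →₀ ℕ)}
    (hI : ∀ i r, ∀ h ∈ flag x (A i) N β (time β q r),
      (∀ e ∈ I i, e.degree = r → (taylor (y i) h).coeff e = 0) → h ∈ vanishing (y i) (r + 1))
    {r : ℕ} {g : MvPolynomial σ F} (hg : g ∈ flag x id N β (time β q r))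
    (h0 : ∀ e : (Σ i, α i) →₀ ℕ, e.degree = r → (∀ i, e.split i ∈ I i) →
      (linSubst (blockSum L) (taylor (x q) g)).coeff e = 0)
    (e : (Σ i, α i) →₀ ℕ) (he : e.degree = r) :
    (linSubst (blockSum L) (taylor (x q) g)).coeff e = 0 := by
  suffices H : ∀ s : Finset ι, ∀ e : (Σ i, α i) →₀ ℕ, e.degree = r →
      (∀ i, i ∉ s → e.split i ∈ I i) →
      (linSubst (blockSum L) (taylor (x q) g)).coeff e = 0 from
    H univ e he (by simp)
  intro s
  induction s using Finset.induction_on with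
  | empty => exact fun e he h => h0 e he (by simpa using h)
  | insert i s _ ih =>
    intro e he h
    have hdecomp := (eq_filter_add_mapDomain_iff i e e (e.split i)).2 ⟨rfl, rfl⟩
    have hdeg : r = (e.split i).degree + (e.filter (fun b => b.1 ≠ i)).degree := by
      rw [← he, add_comm, ← degree_add_mapDomain, ← hdecomp]
    have hmem := slice_mem_flag hA (e := e) (i := i) (hdeg ▸ hg)
    have hvan := hI i _ _ hmem fun f hf hfd => by
      rw [taylor_taylor_neg, coeff_slice]
      refine ih _ (by rw [degree_add_mapDomain]; omega) fun i' hi' => ?_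
      obtain ⟨h1, h2⟩ := (eq_filter_add_mapDomain_iff i _ e f).1 rfl
      by_cases hii : i' = i
      · subst hii
        rwa [h2]
      · convert! h i' (by simp [hii, hi']) using 1
        ext a
        have := DFunLike.congr_fun h1 ⟨i', a⟩
        simp only [Finsupp.filter_apply, ne_eq, hii, not_false_eq_true, if_true] at this
        rw [Finsupp.split_apply, Finsupp.split_apply, this]
    have := mem_vanishing_iff_coeff.1 hvan (e.split i) (Nat.lt_succ_self _)
    rw [taylor_taylor_neg, coeff_slice] at this
    rw [hdecomp]
    exact this

/-- The contribution of a point in the ambient space is at most the product of its contributions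
on complementary planes through it. -/
lemma jump_le_prod_jump [Fintype σ] [DecidableEq σ] (hA : ∀ i z, A i z = x q + L i (z - y i))
    (hinj : ∀ i, Function.Injective (A i)) (hL : Function.Surjective (blockSum L)) :
    jump x id N β q ≤ ∏ i, jump x (A i) N β q := by
  have hy (i : ι) : A i (y i) = x q := by simp [hA]
  choose I hI hI' using fun i => exists_jump_basis (N := N) (β := β) (hinj i) (hy i)
  obtain ⟨M, hM⟩ := (blockSum L).exists_rightInverse_of_surjective (LinearMap.range_eq_top.2 hL)
  let J : Finset ((Σ i, α i) →₀ ℕ) :=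
    (Fintype.piFinset I).map Finsupp.sigmaFinsuppEquivPiFinsupp.symm.toEmbedding
  have hJ (e : (Σ i, α i) →₀ ℕ) (he : ∀ i, e.split i ∈ I i) : e ∈ J := by
    rw [Finset.mem_map_equiv, Fintype.mem_piFinset]
    exact he
  refine le_trans ?_ (Finset.prod_le_prod' fun i _ => hI i)
  rw [← Fintype.card_piFinset, ← Finset.card_map Finsupp.sigmaFinsuppEquivPiFinsupp.symm.toEmbedding]
  refine le_trans (Finset.sum_le_sum (g := fun r => #{e ∈ J | e.degree = r}) fun r _ => ?_) ?_
  · let f : MvPolynomial σ F →ₗ[F] ({e // e ∈ J.filter fun e => e.degree = r} → F) :=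
      LinearMap.pi fun e =>
        lcoeff F e.1 ∘ₗ (linSubst (blockSum L)).toLinearMap ∘ₗ (taylor (x q)).toLinearMap
    refine (finrank_sub_le_finrank_sub f (flag_anti (Nat.le_succ _)) (bot_le : ⊥ ≤ ⊤)
      (fun _ _ => trivial) fun g hg hg0 => ?_).trans (by simp)
    rw [Submodule.mem_bot] at hg0
    rw [mem_flag_time_succ Function.injective_id rfl]
    refine ⟨hg, ?_⟩
    have hG : linSubst (blockSum L) (taylor (x q) g) ∈ idealOfVars _ F ^ (r + 1) := by
      rw [mem_pow_idealOfVars_iff']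
      intro e he
      rcases Nat.lt_succ_iff_lt_or_eq.1 he with he | he
      · exact (mem_pow_idealOfVars_iff' _ _).1 (linSubst_mem_pow (blockSum L)
          (mem_vanishing_of_mem_flag rfl hg)) e he
      · refine coeff_eq_zero_of_blocks hA hI' hg (fun e' he' hs => ?_) e he
        exact congrFun hg0 ⟨e', Finset.mem_filter.2 ⟨hJ e' hs, he'⟩⟩
    have := linSubst_mem_pow M hG
    rwa [linSubst_linSubst _ _ hM] at this
  · rw [← Finset.card_biUnion]
    · exact Finset.card_le_card (by simp [J, Finset.subset_iff])
    · intro r _ r' _ hr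
      exact Finset.disjoint_filter.2 fun e _ h1 h2 => hr (h1.symm.trans h2)

end Tensor

section Dimension

open Module

variable (F : Type*) [Field F]

lemma finrank_restrictTotalDegree (k N : ℕ) :
    finrank F (restrictTotalDegree (Fin k) F N) = (k + N).choose N := by
  classical
  have h1 : finrank F (restrictTotalDegree (Fin k) F N) =
      #((range (N + 1)).biUnion fun s => Finset.finsuppAntidiag (univ : Finset (Fin k)) s) := by
    rw [← Fintype.card_coe, restrictTotalDegree]
    refine finrank_eq_card_basis ((basisRestrictSupport F _).reindex (Equiv.subtypeEquivRight ?_))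
    intro e
    have : (e.sum fun _ a => a) = ∑ i, e i := by
      rw [← Finsupp.degree_eq_sum]
      rfl
    simp [Finset.mem_finsuppAntidiag, this]
  rw [h1, Finset.card_biUnion]
  · simp_rw [Finset.card_finsuppAntidiag_nat_eq_choose]
    clear h1
    induction N with
    | zero => simp
    | succ N ih =>
      rw [Finset.sum_range_succ, ih, show k + (N + 1) = k + N + 1 from rfl, Nat.choose_succ_succ]
      simp
  · intro s _ s' _ hs
    refine Finset.disjoint_left.2 fun e he he' => hs ?_
    rw [Finset.mem_finsuppAntidiag] at he he'
    exact he.1.symm.trans he'.1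

lemma choose_add_le_pow (k N : ℕ) : (k + N).choose N ≤ (N + 1) ^ k := by
  induction k with
  | zero => simp
  | succ k ih =>
    have h := Nat.choose_mul_succ_eq (k + N) N
    have h1 : k + N + 1 - N = k + 1 := by omega
    rw [h1] at h
    have h2 : k + N + 1 ≤ (N + 1) * (k + 1) := by nlinarith [Nat.zero_le (N * k)]
    have h3 : (k + 1 + N).choose N * (k + 1) ≤ (N + 1) ^ (k + 1) * (k + 1) := by
      rw [show k + 1 + N = k + N + 1 by ring, ← h, pow_succ, mul_assoc]
      exact Nat.mul_le_mul ih h2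
    exact Nat.le_of_mul_le_mul_right h3 (Nat.succ_pos k)

lemma pow_le_factorial_mul_choose (n N : ℕ) : (N + 1) ^ n ≤ n.factorial * (n + N).choose N := by
  have h := Nat.pow_succ_le_ascFactorial (N + 1) n
  rw [Nat.ascFactorial_eq_factorial_mul_choose] at h
  rwa [add_comm n N, Nat.choose_symm_add]

lemma prod_finrank_le {ι : Type*} [Fintype ι] (k : ι → ℕ) (N : ℕ) :
    ∏ j, finrank F (restrictTotalDegree (Fin (k j)) F N) ≤
      (∑ j, k j).factorial * finrank F (restrictTotalDegree (Fin (∑ j, k j)) F N) := by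
  simp only [finrank_restrictTotalDegree]
  refine (Finset.prod_le_prod' fun j _ => choose_add_le_pow (k j) N).trans ?_
  rw [Finset.prod_pow_eq_pow_sum]
  exact pow_le_factorial_mul_choose _ _

variable {F} {n m : ℕ} {x : Fin m → Fin n → F}

lemma exists_delay_of_weights (hn : 0 < n) (hx : Function.Injective x) (w : Fin m → ℝ)
    (hw : ∀ q, 0 < w q) (hsum : ∑ q, w q = 1) :
    ∃ (N : ℕ) (β : Fin m → ℕ), ∀ q,
      w q * finrank F (restrictTotalDegree (Fin n) F N) ≤ 2 * jump x id N β q := by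
  have hm : NeZero m := ⟨by rintro rfl; simp at hsum⟩
  obtain ⟨N, hN⟩ := exists_nat_ge (∑ q, 4 * m * n / w q)
  set D := finrank F (restrictTotalDegree (Fin n) F (N + 1)) with hD
  set Δ := D - finrank F (restrictTotalDegree (Fin n) F N) with hΔ
  have hD0 : 0 < D := by
    rw [hD, finrank_restrictTotalDegree]
    exact Nat.choose_pos (by omega)
  have hΔeq : Δ = (n + N).choose (N + 1) := by
    rw [hΔ, hD, finrank_restrictTotalDegree, finrank_restrictTotalDegree, ← add_assoc,
      Nat.choose_succ_succ]
    simp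
  have hΔ1 : 1 ≤ Δ := by
    rw [hΔeq]
    exact Nat.choose_pos (by omega)
  have hΔD : Δ * (n + N + 1) = D * n := by
    rw [hΔeq, hD, finrank_restrictTotalDegree, Nat.choose_mul_succ_eq]
    congr 1
    omega
  have hΔD' : (Δ : ℝ) * (n + N + 1) = D * n := by exact_mod_cast hΔD
  have ha : (D : ℕ) < ∑ q, (⌊w q * D⌋₊ + 1) := by
    have : (D : ℝ) < ∑ q, ((⌊w q * D⌋₊ : ℝ) + 1) := by
      calc (D : ℝ) = ∑ q, w q * D := by rw [← Finset.sum_mul, hsum, one_mul]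
        _ < _ := Finset.sum_lt_sum_of_nonempty univ_nonempty fun q _ => Nat.lt_floor_add_one _
    exact_mod_cast this
  obtain ⟨β, hβ⟩ := exists_delay hx (fun q => ⌊w q * D⌋₊ + 1) (fun q => Nat.succ_pos _) ha
  refine ⟨N + 1, β, fun p => ?_⟩
  have hβ' (q : Fin m) : (jump x id (N + 1) β q : ℝ) ≤ w q * D + 2 * Δ := by
    have h1 : (jump x id (N + 1) β q : ℝ) ≤ ⌊w q * D⌋₊ + 1 + Δ := by exact_mod_cast hβ q
    have h2 := Nat.floor_le (mul_nonneg (hw q).le (Nat.cast_nonneg (α := ℝ) D))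
    have h3 : (1 : ℝ) ≤ Δ := by exact_mod_cast hΔ1
    linarith
  have htot : ∑ q, (jump x id (N + 1) β q : ℝ) = D := by
    exact_mod_cast sum_jump (x := x) (N := N + 1) (β := β) Function.surjective_id
  have hdiff : w p * D + 2 * Δ - jump x id (N + 1) β p ≤ 2 * m * Δ := by
    calc w p * D + 2 * Δ - jump x id (N + 1) β p
        ≤ ∑ q, (w q * D + 2 * Δ - jump x id (N + 1) β q) :=
          Finset.single_le_sum (f := fun q => w q * D + 2 * Δ - (jump x id (N + 1) β q : ℝ))
            (fun q _ => sub_nonneg.2 (hβ' q)) (mem_univ p)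
      _ = 2 * m * Δ := by
          rw [Finset.sum_sub_distrib, Finset.sum_add_distrib, ← Finset.sum_mul, hsum, htot]
          simp
          ring
  have hNp : 4 * m * n / w p ≤ N :=
    (Finset.single_le_sum (f := fun q => 4 * m * n / w q)
      (fun q _ => div_nonneg (by positivity) (hw q).le) (mem_univ p)).trans hN
  rw [div_le_iff₀ (hw p)] at hNp
  have hkey : 4 * m * Δ ≤ w p * D := by
    have hn' : (0 : ℝ) < n := by exact_mod_cast hn
    have h1 : 4 * m * n * Δ ≤ w p * D * n := by
      calc 4 * m * n * Δ ≤ N * w p * Δ := by gcongr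
        _ = w p * (Δ * N) := by ring
        _ ≤ w p * (Δ * (n + N + 1)) := by
          have := hw p
          gcongr
          linarith
        _ = w p * D * n := by rw [hΔD']; ring
    nlinarith
  have : (0 : ℝ) ≤ Δ := by positivity
  linarith

end Dimension

section Planes

open Module

variable {F : Type*} [Field F] {n : ℕ}

lemma exists_affine_parametrisation (k : ℕ) (π : AffineSubspace F (Fin n → F)) :
    ∃ A : (Fin k → F) → (Fin n → F), (π : Set (Fin n → F)).Nonempty → finrank F π.direction = k →
      ∃ (b : Fin n → F) (L : (Fin k → F) →ₗ[F] (Fin n → F)), b ∈ π ∧ Function.Injective L ∧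
        LinearMap.range L = π.direction ∧ ∀ z, A z = b + L z := by
  by_cases h : (π : Set (Fin n → F)).Nonempty ∧ finrank F π.direction = k
  · obtain ⟨⟨b, hb⟩, hk⟩ := h
    let e : (Fin k → F) ≃ₗ[F] π.direction := LinearEquiv.ofFinrankEq _ _ (by simp [hk])
    refine ⟨fun z => b + e z, fun _ _ => ⟨b, π.direction.subtype ∘ₗ e.toLinearMap, hb, ?_, ?_, ?_⟩⟩
    · exact Subtype.val_injective.comp e.injective
    · simp [LinearMap.range_comp]
    · simp
  · exact ⟨0, fun h1 h2 => absurd ⟨h1, h2⟩ h⟩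

lemma blockSum_surjective {ι : Type*} [Fintype ι] [DecidableEq ι] {k : ι → ℕ}
    {L : ∀ i, (Fin (k i) → F) →ₗ[F] (Fin n → F)} (h : ⨆ i, LinearMap.range (L i) = ⊤) :
    Function.Surjective (blockSum L) := by
  rw [← LinearMap.range_eq_top, eq_top_iff, ← h, iSup_le_iff]
  rintro i _ ⟨z, rfl⟩
  exact ⟨_, blockSum_dite L i z⟩

variable {m : ℕ} {x : Fin m → Fin n → F}

lemma exists_factors (hn : 0 < n) (hx : Function.Injective x) (w : Fin m → ℝ)
    (hw : ∀ q, 0 < w q) (hsum : ∑ q, w q = 1) {d : ℕ} (k : Fin d → ℕ) (hk : ∑ j, k j = n) :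
    ∃ s : (j : Fin d) → Fin m → Submodule F (Fin n → F) → ℝ,
      (∀ j q V, 0 ≤ s j q V) ∧
      (∀ (q : Fin m) (V : (j : Fin d) → Submodule F (Fin n → F)),
        (∀ j, finrank F (V j) = k j) → (⨆ j, V j) = ⊤ →
        w q ≤ 2 * n.factorial * ∏ j, s j q (V j)) ∧
      (∀ (j : Fin d) (π : AffineSubspace F (Fin n → F)) (t : Finset (Fin m)),
        (∀ q ∈ t, x q ∈ π) → ∑ q ∈ t, s j q π.direction ≤ 1) := by
  obtain ⟨N, β, hβ⟩ := exists_delay_of_weights hn hx w hw hsum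
  choose A hA using fun (j : Fin d) (π : AffineSubspace F (Fin n → F)) =>
    exists_affine_parametrisation (k j) π
  have hD (k : ℕ) : (0 : ℝ) < finrank F (restrictTotalDegree (Fin k) F N) := by
    rw [finrank_restrictTotalDegree]
    exact_mod_cast Nat.choose_pos (by omega)
  refine ⟨fun j q V => jump x (A j (AffineSubspace.mk' (x q) V)) N β q /
    finrank F (restrictTotalDegree (Fin (k j)) F N), fun j q V => by positivity,
    fun q V hV hVtop => ?_, fun j π t ht => ?_⟩
  · have h (j : Fin d) := hA j (AffineSubspace.mk' (x q) (V j)) ⟨x q, AffineSubspace.self_mem_mk' _ _⟩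
      (by rw [AffineSubspace.direction_mk', hV j])
    choose b L hb hinj hrange hAL using h
    have hy (j : Fin d) : ∃ y, b j + L j y = x q := by
      have : x q - b j ∈ LinearMap.range (L j) := by
        rw [hrange]
        exact AffineSubspace.vsub_mem_direction (AffineSubspace.self_mem_mk' _ _) (hb j)
      obtain ⟨y, hy⟩ := this
      exact ⟨y, by rw [hy]; abel⟩
    choose y hy using hy
    have hjump : jump x id N β q ≤ ∏ j, jump x (A j (AffineSubspace.mk' (x q) (V j))) N β q := by
      refine jump_le_prod_jump (L := L) (y := y) (fun j z => ?_) (fun j => ?_)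
        (blockSum_surjective ?_)
      · rw [hAL, ← hy j, map_sub]
        abel
      · intro z z' hz
        rw [hAL, hAL] at hz
        exact hinj j (add_left_cancel hz)
      · simpa [hrange] using hVtop
    have hprod : ∏ j, (finrank F (restrictTotalDegree (Fin (k j)) F N) : ℝ) ≤
        n.factorial * finrank F (restrictTotalDegree (Fin n) F N) := by
      have := prod_finrank_le F k N
      rw [hk] at this
      exact_mod_cast this
    refine le_of_mul_le_mul_right ?_ (hD n)
    have hpos : 0 < ∏ j, (finrank F (restrictTotalDegree (Fin (k j)) F N) : ℝ) :=
      Finset.prod_pos fun j _ => hD _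
    rw [Finset.prod_div_distrib]
    set P : ℝ := ∏ j, (finrank F (restrictTotalDegree (Fin (k j)) F N) : ℝ)
    set J : ℝ := ∏ j, (jump x (A j (AffineSubspace.mk' (x q) (V j))) N β q : ℝ)
    have hJ : (jump x id N β q : ℝ) ≤ J := by
      simp only [J]
      exact_mod_cast hjump
    have hJ0 : 0 ≤ J / P := by positivity
    calc w q * finrank F (restrictTotalDegree (Fin n) F N) ≤ 2 * jump x id N β q := hβ q
      _ ≤ 2 * J := by gcongr
      _ = 2 * (J / P) * P := by field_simp
      _ ≤ 2 * (J / P) * (n.factorial * finrank F (restrictTotalDegree (Fin n) F N)) := by gcongr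
      _ = _ := by ring
  · have h : ∀ q ∈ t, AffineSubspace.mk' (x q) π.direction = π := fun q hq =>
      AffineSubspace.mk'_eq (ht q hq)
    calc _ = ∑ q ∈ t, (jump x (A j π) N β q : ℝ) /
          finrank F (restrictTotalDegree (Fin (k j)) F N) :=
          Finset.sum_congr rfl fun q hq => by simp only [h q hq]
      _ ≤ 1 := by
          rw [← Finset.sum_div, div_le_one (hD _)]
          exact_mod_cast sum_jump_le t

end Planes

end DiscreteFactorisation

/-- **Discrete Factorisation Theorem.**
Let `d, n` and `k 0, …, k (d-1)` be positive integers with `∑ j, k j = n`. There is a constant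
`C = C(n)`, depending only on `n`, such that for every field `F` and every finitely supported
function `S : Fⁿ → ℝ≥0` with `∑ p, S p ^ d = 1`, there exist, for each `j`, functions
`s j : Fⁿ × Gr(k j, Fⁿ) → ℝ≥0` vanishing whenever `S p = 0`, such that:
(i) for every `p ∈ Fⁿ` and every tuple of subspaces `V j` with `dim (V j) = k j` and
`V 0 + ⋯ + V (d-1) = Fⁿ`, we have `S p ^ d ≤ C * ∏ j, s j p (V j)`; and
(ii) for every `j` and every affine `k j`-plane `π ⊆ Fⁿ`, the (finite) sum
`∑ p ∈ π ∩ supp S, s j p (e π)` is at most 1, where `e π` is the direction of `π`. -/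
theorem discrete_factorisation (n : ℕ) (hn : 0 < n) :
    ∃ C : ℝ, 0 < C ∧
      ∀ (d : ℕ) (k : Fin d → ℕ), 0 < d → (∀ j, 0 < k j) → (∑ j, k j) = n →
      ∀ (F : Type) [Field F] (S : (Fin n → F) → ℝ),
        (∀ p, 0 ≤ S p) → (Function.support S).Finite →
        (∑ᶠ p, S p ^ d) = 1 →
        ∃ s : (j : Fin d) → (Fin n → F) → Submodule F (Fin n → F) → ℝ,
          (∀ j p V, 0 ≤ s j p V) ∧
          (∀ j p V, S p = 0 → s j p V = 0) ∧
          (∀ (p : Fin n → F) (V : (j : Fin d) → Submodule F (Fin n → F)),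
            (∀ j, Module.finrank F (V j) = k j) → (⨆ j, V j) = ⊤ →
            S p ^ d ≤ C * ∏ j, s j p (V j)) ∧
          (∀ (j : Fin d) (π : AffineSubspace F (Fin n → F)),
            (π : Set (Fin n → F)).Nonempty →
            Module.finrank F π.direction = k j →
            (∑ᶠ p ∈ ((π : Set (Fin n → F)) ∩ Function.support S),
              s j p π.direction) ≤ 1) := by
  classical
  refine ⟨2 * n.factorial, by positivity, fun d k hd _ hkn F _ S hS hfin hsum => ?_⟩
  let e := hfin.toFinset.equivFin
  let x (q : Fin hfin.toFinset.card) : Fin n → F := e.symm q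
  have hx : Function.Injective x := Subtype.val_injective.comp e.symm.injective
  have hSx (q) : S (x q) ≠ 0 := hfin.mem_toFinset.1 (e.symm q).2
  have hxe {p} (hp : S p ≠ 0) : x (e ⟨p, by simpa using hp⟩) = p := by simp [x]
  have hw : ∑ q, S (x q) ^ d = 1 := by
    rw [finsum_eq_sum_of_support_subset (s := hfin.toFinset) _ fun p hp => by
        rw [Function.mem_support] at hp
        simpa using fun h => hp (by rw [h, zero_pow hd.ne'])] at hsum
    rw [← hsum, ← Finset.sum_coe_sort hfin.toFinset]
    exact Equiv.sum_comp e.symm fun p => S (p : Fin n → F) ^ d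
  obtain ⟨s, hs0, hs1, hs2⟩ := DiscreteFactorisation.exists_factors hn hx (fun q => S (x q) ^ d)
    (fun q => pow_pos ((hS _).lt_of_ne' (hSx q)) d) hw k hkn
  let s' (j : Fin d) (p : Fin n → F) (V : Submodule F (Fin n → F)) : ℝ :=
    if hp : S p = 0 then 0 else s j (e ⟨p, by simpa using hp⟩) V
  have hs' (j q V) : s' j (x q) V = s j q V := by simp [s', hSx q, x]
  refine ⟨s', fun j p V => ?_, fun j p V hp => by simp [s', hp], fun p V hV hVtop => ?_,
    fun j π _ _ => ?_⟩
  · simp only [s']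
    split_ifs
    exacts [le_rfl, hs0 _ _ _]
  · by_cases hp : S p = 0
    · rw [hp, zero_pow hd.ne']
      exact mul_nonneg (by positivity) (Finset.prod_nonneg fun j _ => by simp [s', hp])
    · rw [← hxe hp]
      simpa only [hs'] using hs1 _ V hV hVtop
  · have hset : (π : Set (Fin n → F)) ∩ Function.support S =
        x '' (Finset.univ.filter fun q => x q ∈ π : Finset _) := by
      ext p
      simp only [Set.mem_inter_iff, SetLike.mem_coe, Function.mem_support, Set.mem_image,
        Finset.mem_filter, Finset.mem_univ, true_and]
      refine ⟨fun h => ⟨_, ?_, hxe h.2⟩, ?_⟩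
      · rw [hxe h.2]
        exact h.1
      · rintro ⟨q, hq, rfl⟩
        exact ⟨hq, hSx q⟩
    rw [hset, finsum_mem_image hx.injOn, finsum_mem_coe_finset]
    simp only [hs']
    exact hs2 j π _ fun q hq => (Finset.mem_filter.1 hq).2
end

section
/- Let d ≥ 2, n and k_1, …, k_d be positive integers with k_1 + ⋯ + k_d = n, let F be a field, and let Π_1, …, Π_d be finite sets of affine k_1-, …, k_d-planes in F^n respectively. There is a constant C = C(n), depending only on n, such that for all functions f_j : Π_j → ℝ_{≥0}, 1 ≤ j ≤ d, one has ∑_{p ∈ F^n} ( ∑_{π_1 ∈ Π_1} ⋯ ∑_{π_d ∈ Π_d} δ(p, π_1, …, π_d) · f_1(π_1) ⋯ f_d(π_d) )^{1/(d-1)} ≤ C · ∏_{j=1}^d ( ∑_{π_j ∈ Π_j} f_j(π_j) )^{1/(d-1)}. -/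
/- The multijoint kernel: `mjDelta p π = 1` if `p` lies on every affine subspace `π j` and the
directions of the `π j` together span the whole space, and `0` otherwise. -/
open Classical in
noncomputable def mjDelta {F : Type} [Field F] {n d : ℕ}
    (p : Fin n → F) (π : Fin d → AffineSubspace F (Fin n → F)) : ℝ :=
  if (∀ j, p ∈ π j) ∧ (⨆ j, (π j).direction) = ⊤ then 1 else 0

namespace Multijoint

open MvPolynomial

section PointIdeal

variable {F : Type*} [Field F] {σ τ : Type*}

/-- The ideal of polynomials vanishing at the point `x`; membership in its `s`-th power says that
the polynomial vanishes to order at least `s` at `x`. -/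
noncomputable def pointIdeal (x : σ → F) : Ideal (MvPolynomial σ F) :=
  Ideal.span (Set.range fun i => X i - C (x i))

lemma sub_C_eval_mem_pointIdeal (x : σ → F) (f : MvPolynomial σ F) :
    f - C (eval x f) ∈ pointIdeal x := by
  induction f using MvPolynomial.induction_on with
  | C a => simp
  | add p q hp hq =>
    have : p + q - C (eval x (p + q)) = (p - C (eval x p)) + (q - C (eval x q)) := by
      simp only [map_add]; ring
    rw [this]
    exact add_mem hp hq
  | mul_X p i hp =>
    have : p * X i - C (eval x (p * X i))
        = X i * (p - C (eval x p)) + C (eval x p) * (X i - C (x i)) := by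
      simp only [map_mul, eval_X]; ring
    rw [this]
    exact add_mem (Ideal.mul_mem_left _ _ hp)
      (Ideal.mul_mem_left _ _ (Ideal.subset_span ⟨i, rfl⟩))

lemma mem_pointIdeal_of_eval_eq_zero {x : σ → F} {f : MvPolynomial σ F} (h : eval x f = 0) :
    f ∈ pointIdeal x := by
  simpa [h] using sub_C_eval_mem_pointIdeal x f

lemma aeval_mem_pointIdeal_pow {x : σ → F} {y : τ → F} {c : σ → MvPolynomial τ F}
    (hc : ∀ i, eval y (c i) = x i) {s : ℕ} {f : MvPolynomial σ F} (hf : f ∈ pointIdeal x ^ s) :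
    aeval c f ∈ pointIdeal y ^ s := by
  have hle : (pointIdeal x).map (aeval c : MvPolynomial σ F →ₐ[F] _) ≤ pointIdeal y := by
    rw [pointIdeal, Ideal.map_span, Ideal.span_le]
    rintro _ ⟨_, ⟨i, rfl⟩, rfl⟩
    exact mem_pointIdeal_of_eval_eq_zero (by simp [hc])
  have := Ideal.mem_map_of_mem (aeval c : MvPolynomial σ F →ₐ[F] _) hf
  rw [Ideal.map_pow] at this
  exact Ideal.pow_right_mono hle s this

lemma pointIdeal_zero : pointIdeal (0 : σ → F) = idealOfVars σ F := by
  simp [pointIdeal, idealOfVars]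

/-- Substitution `X ↦ X + u`. -/
noncomputable def translate (u : σ → F) : MvPolynomial σ F →ₐ[F] MvPolynomial σ F :=
  aeval fun i => X i + C (u i)

lemma translate_translate_of_add_eq_zero {u v : σ → F} (h : u + v = 0) (f : MvPolynomial σ F) :
    translate u (translate v f) = f := by
  have : (translate u).comp (translate v) = AlgHom.id F (MvPolynomial σ F) := by
    ext i : 1
    have hi : u i + v i = 0 := congrFun h i
    simp [translate, add_assoc, ← C_add, hi, algebraMap_eq]
  exact DFunLike.congr_fun this f

lemma translate_mem_pointIdeal_pow {u x y : σ → F} (h : x = y + u) {s : ℕ}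
    {f : MvPolynomial σ F} (hf : f ∈ pointIdeal x ^ s) : translate u f ∈ pointIdeal y ^ s :=
  aeval_mem_pointIdeal_pow (by simp [h]) hf

lemma mem_pointIdeal_pow_iff {u : σ → F} {s : ℕ} {f : MvPolynomial σ F} :
    f ∈ pointIdeal u ^ s ↔ ∀ e : σ →₀ ℕ, e.degree < s → coeff e (translate u f) = 0 := by
  rw [← mem_pow_idealOfVars_iff', ← pointIdeal_zero]
  refine ⟨translate_mem_pointIdeal_pow (by simp), fun h => ?_⟩
  rw [← translate_translate_of_add_eq_zero (neg_add_cancel u) f]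
  exact translate_mem_pointIdeal_pow (by simp) h

lemma homogeneousComponent_translate_eq_zero {u : σ → F} {s : ℕ} {f : MvPolynomial σ F}
    (hf : f ∈ pointIdeal u ^ (s + 1)) : homogeneousComponent s (translate u f) = 0 := by
  ext e
  rw [coeff_homogeneousComponent, coeff_zero]
  split_ifs with h
  · exact mem_pointIdeal_pow_iff.1 hf e (by omega)
  · rfl

lemma totalDegree_aeval_le {c : σ → MvPolynomial τ F} (hc : ∀ i, (c i).totalDegree ≤ 1)
    (f : MvPolynomial σ F) : (aeval c f).totalDegree ≤ f.totalDegree := by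
  rw [aeval_def, eval₂_eq]
  refine totalDegree_finsetSum_le fun e he => ?_
  refine (totalDegree_mul _ _).trans ?_
  rw [algebraMap_eq, totalDegree_C, zero_add]
  refine (totalDegree_finsetProd _ _).trans (le_trans ?_ (le_totalDegree he))
  exact Finset.sum_le_sum fun i _ => (totalDegree_pow _ _).trans
    ((Nat.mul_le_mul_left _ (hc i)).trans (by simp))

lemma totalDegree_X_add_C_le (i : σ) (a : F) : (X i + C a : MvPolynomial σ F).totalDegree ≤ 1 :=
  (totalDegree_add _ _).trans (by simp)

lemma totalDegree_translate_le (u : σ → F) (f : MvPolynomial σ F) :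
    (translate u f).totalDegree ≤ f.totalDegree :=
  totalDegree_aeval_le (fun _ => totalDegree_X_add_C_le _ _) f

lemma translate_injective (u : σ → F) : Function.Injective (translate u) :=
  Function.LeftInverse.injective (g := translate (-u))
    (translate_translate_of_add_eq_zero (neg_add_cancel u))

lemma eq_zero_of_mem_pointIdeal_pow {u : σ → F} {s : ℕ} {f : MvPolynomial σ F}
    (hf : f ∈ pointIdeal u ^ s) (hs : f.totalDegree < s) : f = 0 := by
  apply translate_injective u
  rw [map_zero]
  ext e
  rw [coeff_zero]
  by_cases he : e.degree < s
  · exact mem_pointIdeal_pow_iff.1 hf e he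
  · exact coeff_eq_zero_of_totalDegree_lt
      (lt_of_le_of_lt (totalDegree_translate_le u f) (by
        have : e.degree = ∑ i ∈ e.support, e i := rfl
        omega))

lemma exists_order {f : MvPolynomial σ F} (hf : f ≠ 0) (u : σ → F) :
    ∃ v, f ∈ pointIdeal u ^ v ∧ f ∉ pointIdeal u ^ (v + 1) := by
  classical
  have h : ∃ s, f ∉ pointIdeal u ^ (s + 1) :=
    ⟨f.totalDegree, fun h => hf (eq_zero_of_mem_pointIdeal_pow h (Nat.lt_succ_self _))⟩
  refine ⟨Nat.find h, ?_, Nat.find_spec h⟩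
  rcases hv : Nat.find h with _ | v
  · simp
  · exact not_not.1 (Nat.find_min h (m := v) (by omega))

lemma mem_pointIdeal_pow_of_mul_mem {u : σ → F} {g f : MvPolynomial σ F} (hg : eval u g ≠ 0)
    {s : ℕ} (h : g * f ∈ pointIdeal u ^ s) : f ∈ pointIdeal u ^ s := by
  induction s with
  | zero => simp
  | succ s ih =>
    have hfs := ih (Ideal.pow_le_pow_right (Nat.le_succ s) h)
    have hsub : (g - C (eval u g)) * f ∈ pointIdeal u ^ (s + 1) := by
      rw [pow_succ']
      exact Ideal.mul_mem_mul (sub_C_eval_mem_pointIdeal u g) hfs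
    have hC : C (eval u g) * f ∈ pointIdeal u ^ (s + 1) := by
      have : C (eval u g) * f = g * f - (g - C (eval u g)) * f := by ring
      rw [this]
      exact sub_mem h hsub
    have := Ideal.mul_mem_left _ (C (eval u g)⁻¹) hC
    rwa [← mul_assoc, ← C_mul, inv_mul_cancel₀ hg, C_1, one_mul] at this

end PointIdeal

end Multijoint

namespace Multijoint

open MvPolynomial

section TensorFunctional

variable {F : Type*} [Field F] {σ : Type*} {ι : Type*} [Fintype ι] [DecidableEq ι] {η : ι → Type*}

/-- A functional on polynomials that only sees the homogeneous component of degree `r`. -/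
def IsHomogeneousFunctional (ψ : MvPolynomial σ F →ₗ[F] F) (r : ℕ) : Prop :=
  ∀ e : σ →₀ ℕ, e.degree ≠ r → ψ (monomial e 1) = 0

omit [DecidableEq ι] in
lemma degree_eq_sum_split [∀ i, Fintype (η i)] (e : (Σ i, η i) →₀ ℕ) :
    e.degree = ∑ i, (e.split i).degree := by
  simp [Finsupp.degree_eq_sum, Fintype.sum_sigma, Finsupp.split_apply]

/-- The partial contraction `⨂_{i ≠ j} ψ i`, a map from polynomials in all the variables to
polynomials in the variables of block `j`. -/
noncomputable def contract (j : ι) (ψ : ∀ i, MvPolynomial (η i) F →ₗ[F] F) :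
    MvPolynomial (Σ i, η i) F →ₗ[F] MvPolynomial (η j) F :=
  (basisMonomials _ F).constr F fun e =>
    (∏ i ∈ Finset.univ.erase j, ψ i (monomial (e.split i) 1)) • monomial (e.split j) 1

/-- The functional `⨂ i, ψ i`. -/
noncomputable def tensorFunctional (ψ : ∀ i, MvPolynomial (η i) F →ₗ[F] F) :
    MvPolynomial (Σ i, η i) F →ₗ[F] F :=
  (basisMonomials _ F).constr F fun e => ∏ i, ψ i (monomial (e.split i) 1)

lemma contract_monomial (j : ι) (ψ : ∀ i, MvPolynomial (η i) F →ₗ[F] F) (e : (Σ i, η i) →₀ ℕ) :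
    contract j ψ (monomial e 1) =
      (∏ i ∈ Finset.univ.erase j, ψ i (monomial (e.split i) 1)) • monomial (e.split j) 1 := by
  have := (basisMonomials (Σ i, η i) F).constr_basis F (fun e =>
    (∏ i ∈ Finset.univ.erase j, ψ i (monomial (e.split i) 1)) •
      (monomial (e.split j) 1 : MvPolynomial (η j) F)) e
  simpa [contract] using this

omit [DecidableEq ι] in
lemma tensorFunctional_monomial (ψ : ∀ i, MvPolynomial (η i) F →ₗ[F] F)
    (e : (Σ i, η i) →₀ ℕ) :
    tensorFunctional ψ (monomial e 1) = ∏ i, ψ i (monomial (e.split i) 1) := by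
  have := (basisMonomials (Σ i, η i) F).constr_basis F (fun e =>
    ∏ i, ψ i (monomial (e.split i) 1)) e
  simpa [tensorFunctional] using this

lemma linearMap_ext_monomial {M : Type*} [AddCommGroup M] [Module F M]
    {f g : MvPolynomial σ F →ₗ[F] M} (h : ∀ e, f (monomial e 1) = g (monomial e 1)) : f = g :=
  (basisMonomials σ F).ext (by simpa using h)

lemma tensorFunctional_eq_contract (j : ι) (ψ : ∀ i, MvPolynomial (η i) F →ₗ[F] F)
    (f : MvPolynomial (Σ i, η i) F) : tensorFunctional ψ f = ψ j (contract j ψ f) := by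
  have : tensorFunctional ψ = (ψ j).comp (contract j ψ) := linearMap_ext_monomial fun e => by
    rw [tensorFunctional_monomial, LinearMap.comp_apply, contract_monomial, map_smul, smul_eq_mul,
      Finset.prod_erase_mul _ _ (Finset.mem_univ j)]
  rw [this, LinearMap.comp_apply]

lemma contract_congr {j : ι} {ψ ψ' : ∀ i, MvPolynomial (η i) F →ₗ[F] F}
    (h : ∀ i ≠ j, ψ i = ψ' i) : contract j ψ = contract j ψ' :=
  linearMap_ext_monomial fun e => by
    rw [contract_monomial, contract_monomial]
    congr 1
    exact Finset.prod_congr rfl fun i hi => by rw [h i (Finset.ne_of_mem_erase hi)]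

lemma homogeneousComponent_monomial_one (v : ℕ) (e : σ →₀ ℕ) :
    homogeneousComponent v (monomial e (1 : F)) = if e.degree = v then monomial e 1 else 0 := by
  classical
  ext e'
  rw [coeff_homogeneousComponent]
  by_cases he : e = e'
  · subst he
    split_ifs <;> simp
  · split_ifs <;> simp [coeff_monomial, he]

omit [DecidableEq ι] in
lemma tensorFunctional_homogeneousComponent [∀ i, Fintype (η i)]
    {ψ : ∀ i, MvPolynomial (η i) F →ₗ[F] F} {r : ι → ℕ}
    (hψ : ∀ i, IsHomogeneousFunctional (ψ i) (r i)) (v : ℕ) (f : MvPolynomial (Σ i, η i) F)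
    (hf : tensorFunctional ψ f = 0) :
    tensorFunctional ψ (homogeneousComponent v f) = 0 := by
  by_cases hv : ∑ i, r i = v
  · have : (tensorFunctional ψ).comp (homogeneousComponent v) = tensorFunctional ψ :=
      linearMap_ext_monomial fun e => by
        rw [LinearMap.comp_apply, homogeneousComponent_monomial_one]
        split_ifs with he
        · rfl
        · rw [map_zero, tensorFunctional_monomial]
          obtain ⟨i, hi⟩ : ∃ i, (e.split i).degree ≠ r i := by
            by_contra! hcon
            exact he (by rw [degree_eq_sum_split, ← hv, Finset.sum_congr rfl fun i _ => hcon i])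
          exact (Finset.prod_eq_zero (Finset.mem_univ i) (hψ i _ hi)).symm
    rw [← LinearMap.comp_apply, this, hf]
  · have : (tensorFunctional ψ).comp (homogeneousComponent v) = 0 :=
      linearMap_ext_monomial fun e => by
        rw [LinearMap.comp_apply, homogeneousComponent_monomial_one]
        split_ifs with he
        · rw [tensorFunctional_monomial]
          obtain ⟨i, hi⟩ : ∃ i, (e.split i).degree ≠ r i := by
            by_contra! hcon
            exact hv (by rw [← he, degree_eq_sum_split, Finset.sum_congr rfl fun i _ => hcon i])
          exact Finset.prod_eq_zero (Finset.mem_univ i) (hψ i _ hi)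
        · simp
    rw [← LinearMap.comp_apply, this, LinearMap.zero_apply]

lemma contract_homogeneousComponent [∀ i, Fintype (η i)] (j : ι)
    {ψ : ∀ i, MvPolynomial (η i) F →ₗ[F] F} {r : ι → ℕ}
    (hψ : ∀ i, IsHomogeneousFunctional (ψ i) (r i)) (v : ℕ) (f : MvPolynomial (Σ i, η i) F) :
    contract j ψ (homogeneousComponent v f) =
      if ∑ i ∈ Finset.univ.erase j, r i ≤ v then
        homogeneousComponent (v - ∑ i ∈ Finset.univ.erase j, r i) (contract j ψ f) else 0 := by
  have key : ∀ e : (Σ i, η i) →₀ ℕ, (∀ i ∈ Finset.univ.erase j, (e.split i).degree = r i) →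
      e.degree = (∑ i ∈ Finset.univ.erase j, r i) + (e.split j).degree := fun e he => by
    rw [degree_eq_sum_split, ← Finset.sum_erase_add _ _ (Finset.mem_univ j),
      Finset.sum_congr rfl he]
  have h0 : ∀ e : (Σ i, η i) →₀ ℕ, (¬ ∀ i ∈ Finset.univ.erase j, (e.split i).degree = r i) →
      contract j ψ (monomial e 1) = 0 := fun e he => by
    push Not at he
    obtain ⟨i, hi, hne⟩ := he
    rw [contract_monomial, Finset.prod_eq_zero hi (hψ i _ hne), zero_smul]
  split_ifs with hv
  · have : (contract j ψ).comp (homogeneousComponent v) =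
        (homogeneousComponent (v - ∑ i ∈ Finset.univ.erase j, r i)).comp (contract j ψ) :=
      linearMap_ext_monomial fun e => by
        rw [LinearMap.comp_apply, LinearMap.comp_apply, homogeneousComponent_monomial_one]
        by_cases he : ∀ i ∈ Finset.univ.erase j, (e.split i).degree = r i
        · have := key e he
          rw [contract_monomial, map_smul, homogeneousComponent_monomial_one]
          split_ifs with h1 h2 h2
          · rw [contract_monomial]
          · omega
          · omega
          · simp
        · rw [h0 e he]
          split_ifs
          · rw [h0 e he, map_zero]
          · simp
    exact DFunLike.congr_fun this f
  · have : (contract j ψ).comp (homogeneousComponent v) = 0 :=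
      linearMap_ext_monomial fun e => by
        rw [LinearMap.comp_apply, homogeneousComponent_monomial_one]
        split_ifs with h1
        · refine h0 e fun he => ?_
          have := key e he
          omega
        · simp
    exact DFunLike.congr_fun this f

lemma eq_zero_of_tensorFunctional_eq_zero [∀ i, Fintype (η i)] {κ : ι → Type*}
    {θ : ∀ i, κ i → MvPolynomial (η i) F →ₗ[F] F} {deg : ∀ i, κ i → ℕ}
    (hθ : ∀ i s, IsHomogeneousFunctional (θ i s) (deg i s)) {G : MvPolynomial (Σ i, η i) F}
    (hsep : ∀ j, ∀ ψ : ∀ i, MvPolynomial (η i) F →ₗ[F] F, ∀ r : ι → ℕ,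
      (∀ i, IsHomogeneousFunctional (ψ i) (r i)) →
      (∀ s, θ j s (contract j ψ G) = 0) → contract j ψ G = 0)
    (hG : ∀ s : ∀ i, κ i, tensorFunctional (fun i => θ i (s i)) G = 0) : G = 0 := by
  have key : ∀ (T : Finset ι) (ψ : ∀ i, MvPolynomial (η i) F →ₗ[F] F) (r : ι → ℕ),
      (∀ i, IsHomogeneousFunctional (ψ i) (r i)) → (∀ i ∉ T, ∃ s, ψ i = θ i s) →
      tensorFunctional ψ G = 0 := by
    intro T
    induction T using Finset.induction_on with
    | empty =>
      intro ψ r _ h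
      choose s hs using fun i => h i (Finset.notMem_empty i)
      have : ψ = fun i => θ i (s i) := funext hs
      rw [this, hG]
    | insert j T hj ih =>
      intro ψ r hψ h
      rw [tensorFunctional_eq_contract j, hsep j ψ r hψ, map_zero]
      intro s
      have := ih (Function.update ψ j (θ j s)) (Function.update r j (deg j s)) ?_ ?_
      · rw [tensorFunctional_eq_contract j, Function.update_self,
          contract_congr (ψ' := ψ) fun i hi => Function.update_of_ne hi _ _] at this
        exact this
      · intro i
        rcases eq_or_ne i j with rfl | hi
        · simpa using hθ i s
        · simpa [hi] using hψ i
      · intro i hi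
        rcases eq_or_ne i j with rfl | hij
        · exact ⟨s, by simp⟩
        · obtain ⟨s', hs'⟩ := h i (by simp [hij, hi])
          exact ⟨s', by simpa [hij] using hs'⟩
  ext e
  rw [coeff_zero, ← key Finset.univ (fun i => lcoeff F (e.split i)) (fun i => (e.split i).degree)
    ?_ (by simp)]
  · have : lcoeff F e = tensorFunctional fun i => lcoeff F (e.split i) :=
      linearMap_ext_monomial fun e' => by
        classical
        rw [tensorFunctional_monomial]
        simp only [lcoeff_apply, coeff_monomial]
        split_ifs with h
        · simp [h]
        · obtain ⟨i, hi⟩ : ∃ i, e'.split i ≠ e.split i := by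
            by_contra! hcon
            refine h (Finsupp.ext fun ⟨i, x⟩ => ?_)
            rw [← Finsupp.split_apply, hcon i, Finsupp.split_apply]
          exact (Finset.prod_eq_zero (Finset.mem_univ i) (by simp [hi])).symm
    exact DFunLike.congr_fun this G
  · classical
    intro i e' he'
    rw [lcoeff_apply, coeff_monomial, if_neg]
    rintro rfl
    exact he' rfl

omit [Fintype ι] in
lemma split_single_add_self (j : ι) (x : η j) (e : (Σ i, η i) →₀ ℕ) :
    (Finsupp.single (⟨j, x⟩ : Σ i, η i) 1 + e).split j = Finsupp.single x 1 + e.split j := by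
  classical
  ext y
  simp [Finsupp.split_apply, Finsupp.single_apply]

omit [Fintype ι] [DecidableEq ι] in
lemma split_single_add_of_ne {i j : ι} (h : i ≠ j) (x : η i) (e : (Σ i, η i) →₀ ℕ) :
    (Finsupp.single (⟨i, x⟩ : Σ i, η i) 1 + e).split j = e.split j := by
  classical
  ext y
  simp [Finsupp.split_apply, h]

lemma X_mul_monomial_one (x : σ) (e : σ →₀ ℕ) :
    X x * monomial e (1 : F) = monomial (Finsupp.single x 1 + e) 1 := by
  rw [X, monomial_mul, one_mul]

lemma contract_X_mul_self (j : ι) (ψ : ∀ i, MvPolynomial (η i) F →ₗ[F] F) (x : η j)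
    (f : MvPolynomial (Σ i, η i) F) :
    contract j ψ (X ⟨j, x⟩ * f) = X x * contract j ψ f := by
  have : (contract j ψ).comp (LinearMap.mulLeft F (X ⟨j, x⟩)) =
      (LinearMap.mulLeft F (X x)).comp (contract j ψ) := linearMap_ext_monomial fun e => by
    simp only [LinearMap.comp_apply, LinearMap.mulLeft_apply]
    rw [X_mul_monomial_one, contract_monomial, contract_monomial, mul_smul_comm,
      X_mul_monomial_one, split_single_add_self]
    congr 1
    exact Finset.prod_congr rfl fun i hi => by
      rw [split_single_add_of_ne (Finset.ne_of_mem_erase hi).symm]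
  exact DFunLike.congr_fun this f

lemma contract_X_mul_of_ne {i j : ι} (hij : i ≠ j) (ψ : ∀ i, MvPolynomial (η i) F →ₗ[F] F)
    (x : η i) (f : MvPolynomial (Σ i, η i) F) :
    contract j ψ (X ⟨i, x⟩ * f) =
      contract j (Function.update ψ i ((ψ i).comp (LinearMap.mulLeft F (X x)))) f := by
  have : (contract j ψ).comp (LinearMap.mulLeft F (X ⟨i, x⟩)) =
      contract j (Function.update ψ i ((ψ i).comp (LinearMap.mulLeft F (X x)))) :=
    linearMap_ext_monomial fun e => by
      rw [LinearMap.comp_apply, LinearMap.mulLeft_apply, X_mul_monomial_one, contract_monomial,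
        contract_monomial, split_single_add_of_ne hij]
      congr 1
      refine Finset.prod_congr rfl fun i' _ => ?_
      rcases eq_or_ne i' i with rfl | hi
      · rw [Function.update_self, LinearMap.comp_apply, LinearMap.mulLeft_apply,
          X_mul_monomial_one, split_single_add_self]
      · rw [Function.update_of_ne hi, split_single_add_of_ne hi.symm]
  exact DFunLike.congr_fun this f

lemma IsHomogeneousFunctional.comp_mulLeft_X {ψ : MvPolynomial σ F →ₗ[F] F} {r : ℕ}
    (hψ : IsHomogeneousFunctional ψ r) (x : σ) :
    IsHomogeneousFunctional (ψ.comp (LinearMap.mulLeft F (X x))) (r - 1) := by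
  intro e he
  rw [LinearMap.comp_apply, LinearMap.mulLeft_apply, X_mul_monomial_one]
  apply hψ
  rw [map_add, Finsupp.degree_single]
  omega

lemma IsHomogeneousFunctional.comp_mulLeft_X_eq_zero {ψ : MvPolynomial σ F →ₗ[F] F}
    (hψ : IsHomogeneousFunctional ψ 0) (x : σ) :
    ψ.comp (LinearMap.mulLeft F (X x)) = 0 :=
  linearMap_ext_monomial fun e => by
    rw [LinearMap.comp_apply, LinearMap.mulLeft_apply, X_mul_monomial_one, LinearMap.zero_apply]
    apply hψ
    rw [map_add, Finsupp.degree_single]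
    omega

lemma contract_eq_zero_of_eq_zero {i j : ι} (hij : i ≠ j) {ψ : ∀ i, MvPolynomial (η i) F →ₗ[F] F}
    (h : ψ i = 0) (f : MvPolynomial (Σ i, η i) F) : contract j ψ f = 0 := by
  have : contract j ψ = 0 := linearMap_ext_monomial fun e => by
    rw [contract_monomial, Finset.prod_eq_zero (i := i) (by simp [hij]) (by simp [h]), zero_smul,
      LinearMap.zero_apply]
  rw [this, LinearMap.zero_apply]

lemma contract_mem_pointIdeal_pow (j : ι) {y : (Σ i, η i) → F}
    (hy : ∀ i ≠ j, ∀ x, y ⟨i, x⟩ = 0) (s : ℕ) :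
    ∀ f ∈ pointIdeal y ^ s, ∀ (ψ : ∀ i, MvPolynomial (η i) F →ₗ[F] F) (r : ι → ℕ),
      (∀ i, IsHomogeneousFunctional (ψ i) (r i)) →
      contract j ψ f ∈
        pointIdeal (fun x => y ⟨j, x⟩) ^ (s - ∑ i ∈ Finset.univ.erase j, r i) := by
  induction s with
  | zero => simp
  | succ s ih =>
    intro f hf
    rw [pow_succ'] at hf
    refine Submodule.mul_induction_on hf ?_ ?_
    · intro a ha
      induction ha using Submodule.span_induction with
      | mem a ha =>
        obtain ⟨⟨i, x⟩, rfl⟩ := ha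
        intro b hb ψ r hψ
        rw [sub_mul, map_sub, C_mul', map_smul]
        rcases eq_or_ne i j with rfl | hij
        · rw [contract_X_mul_self, smul_eq_C_mul, ← sub_mul]
          have h1 := ih b hb ψ r hψ
          refine Ideal.pow_le_pow_right
            (show _ ≤ s - ∑ i' ∈ Finset.univ.erase i, r i' + 1 by omega) ?_
          rw [pow_succ']
          exact Ideal.mul_mem_mul (Ideal.subset_span ⟨x, rfl⟩) h1
        · rw [hy i hij, zero_smul, sub_zero, contract_X_mul_of_ne hij]
          rcases Nat.eq_zero_or_pos (r i) with h0 | hpos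
          · rw [contract_eq_zero_of_eq_zero hij]
            · exact zero_mem _
            · rw [Function.update_self]
              exact IsHomogeneousFunctional.comp_mulLeft_X_eq_zero (h0 ▸ hψ i) x
          · have h1 := ih b hb (Function.update ψ i ((ψ i).comp (LinearMap.mulLeft F (X x))))
              (Function.update r i (r i - 1)) ?_
            · have hsum : ∑ i' ∈ Finset.univ.erase j, Function.update r i (r i - 1) i' + 1
                  = ∑ i' ∈ Finset.univ.erase j, r i' := by
                have hi : i ∈ Finset.univ.erase j := by simp [hij]
                rw [← Finset.add_sum_erase _ _ hi, ← Finset.add_sum_erase _ r hi,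
                  Function.update_self, Finset.sum_congr rfl fun i' hi' =>
                    Function.update_of_ne (Finset.ne_of_mem_erase hi') _ _]
                omega
              convert h1 using 2
              omega
            · intro i'
              rcases eq_or_ne i' i with rfl | hi
              · simpa using (hψ i').comp_mulLeft_X x
              · simpa [hi] using hψ i'
      | zero => intro b _ ψ r _; simp
      | add a a' _ _ h h' =>
        intro b hb ψ r hψ
        rw [add_mul, map_add]
        exact add_mem (h b hb ψ r hψ) (h' b hb ψ r hψ)
      | smul c a _ h =>
        intro b hb ψ r hψ
        have : c • a * b = a * (c * b) := by rw [smul_eq_mul]; ring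
        rw [this]
        exact h _ (Ideal.mul_mem_left _ _ hb) ψ r hψ
    · intro a b ha hb ψ r hψ
      rw [map_add]
      exact add_mem (ha ψ r hψ) (hb ψ r hψ)

lemma totalDegree_contract_le [∀ i, Fintype (η i)] (j : ι)
    (ψ : ∀ i, MvPolynomial (η i) F →ₗ[F] F) (f : MvPolynomial (Σ i, η i) F) :
    (contract j ψ f).totalDegree ≤ f.totalDegree := by
  conv_lhs => rw [f.as_sum, map_sum]
  refine totalDegree_finsetSum_le fun e he => ?_
  have : monomial e (coeff e f) = coeff e f • monomial e (1 : F) := by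
    rw [smul_monomial, smul_eq_mul, mul_one]
  rw [this, map_smul, contract_monomial]
  refine (totalDegree_smul_le _ _).trans ((totalDegree_smul_le _ _).trans
    ((totalDegree_monomial_le _ _).trans (le_trans ?_ (le_totalDegree he))))
  change (e.split j).degree ≤ e.degree
  rw [degree_eq_sum_split]
  exact Finset.single_le_sum (f := fun i => (e.split i).degree) (fun _ _ => Nat.zero_le _)
    (Finset.mem_univ j)

end TensorFunctional

end Multijoint

namespace Multijoint

open MvPolynomial

section FiniteDimension

variable {F E E' : Type*} [Field F] [AddCommGroup E] [Module F E] [AddCommGroup E'] [Module F E']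

lemma finrank_map_le_sub {X X' : Submodule F E} [FiniteDimensional F X] (f : E →ₗ[F] E')
    (hX : X' ≤ X) (hf : ∀ x ∈ X', f x = 0) :
    Module.finrank F (X.map f) ≤ Module.finrank F X - Module.finrank F X' := by
  have h1 := (f.domRestrict X).finrank_range_add_finrank_ker
  rw [LinearMap.range_domRestrict] at h1
  have h2 : Module.finrank F X' ≤ Module.finrank F (LinearMap.ker (f.domRestrict X)) := by
    refine LinearMap.finrank_le_finrank_of_injective
      (f := (Submodule.inclusion hX).codRestrict (LinearMap.ker (f.domRestrict X)) ?_) ?_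
    · intro x
      simpa using hf x x.2
    · intro x y hxy
      have := congrArg (fun z : LinearMap.ker (f.domRestrict X) => ((z : X) : E)) hxy
      exact Subtype.ext (by simpa using this)
  omega

lemma finrank_sub_le_finrank_map {X X' : Submodule F E} [FiniteDimensional F X] (f : E →ₗ[F] E')
    (hX : X' ≤ X) (hf : ∀ x ∈ X, f x = 0 → x ∈ X') :
    Module.finrank F X - Module.finrank F X' ≤ Module.finrank F (X.map f) := by
  have h1 := (f.domRestrict X).finrank_range_add_finrank_ker
  rw [LinearMap.range_domRestrict] at h1
  have : FiniteDimensional F X' := Submodule.finiteDimensional_of_le hX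
  have h2 : Module.finrank F (LinearMap.ker (f.domRestrict X)) ≤ Module.finrank F X' := by
    refine LinearMap.finrank_le_finrank_of_injective
      (f := (X.subtype.comp (LinearMap.ker (f.domRestrict X)).subtype).codRestrict X' ?_) ?_
    · intro x
      exact hf x x.1.2 (LinearMap.mem_ker.1 x.2)
    · intro x y hxy
      exact Subtype.ext (Subtype.ext (congrArg (fun z : X' => (z : E)) hxy))
  omega

lemma finrank_sub_finrank_le {X X' : Submodule F E} {Y Y' : Submodule F E'}
    [FiniteDimensional F X] [FiniteDimensional F Y] (f : E →ₗ[F] E') (hX : X' ≤ X) (hY : Y' ≤ Y)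
    (hf : ∀ x ∈ X, f x ∈ Y) (hf' : ∀ x ∈ X, f x ∈ Y' → x ∈ X') :
    Module.finrank F X - Module.finrank F X' ≤ Module.finrank F Y - Module.finrank F Y' := by
  refine (finrank_sub_le_finrank_map (Y'.mkQ.comp f) hX fun x hx h => hf' x hx ?_).trans
    (le_trans ?_ (finrank_map_le_sub Y'.mkQ hY fun y hy => ?_))
  · simpa using h
  · rw [Submodule.map_comp]
    have : FiniteDimensional F (Y.map Y'.mkQ) := inferInstance
    refine Submodule.finrank_mono (Submodule.map_mono ?_)
    rintro _ ⟨x, hx, rfl⟩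
    exact hf x hx
  · simpa using hy

end FiniteDimension

section Filtration

variable {F : Type*} [Field F] {σ : Type*} [Fintype σ] {N : ℕ}

/-- Polynomials of degree at most `m` that, for every `q ∈ S`, vanish at `u q` to order at least
`t - a q`, and to order at least `t + 1 - a q` if `q < i`. -/
noncomputable def filtration (S : Set (Fin N)) (u : Fin N → σ → F) (m : ℕ) (a : Fin N → ℕ)
    (t i : ℕ) : Submodule F (MvPolynomial σ F) :=
  restrictTotalDegree σ F m ⊓
    ⨅ q ∈ S, (pointIdeal (u q) ^ (t + (if (q : ℕ) < i then 1 else 0) - a q)).restrictScalars F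

variable {S : Set (Fin N)} {u : Fin N → σ → F} {m : ℕ} {a : Fin N → ℕ} {t i : ℕ}

omit [Fintype σ] in
lemma mem_filtration {f : MvPolynomial σ F} :
    f ∈ filtration S u m a t i ↔ f.totalDegree ≤ m ∧
      ∀ q ∈ S, f ∈ pointIdeal (u q) ^ (t + (if (q : ℕ) < i then 1 else 0) - a q) := by
  simp [filtration, mem_restrictTotalDegree, Submodule.mem_iInf]

instance : FiniteDimensional F (filtration S u m a t i) :=
  Submodule.finiteDimensional_of_le (inf_le_left : _ ≤ restrictTotalDegree σ F m)

omit [Fintype σ] in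
lemma filtration_succ_le (p : ℕ) : filtration S u m a t (p + 1) ≤ filtration S u m a t p := by
  intro f hf
  rw [mem_filtration] at hf ⊢
  refine ⟨hf.1, fun q hq => Ideal.pow_le_pow_right ?_ (hf.2 q hq)⟩
  split_ifs <;> omega

omit [Fintype σ] in
lemma mem_filtration_succ {p : Fin N} {f : MvPolynomial σ F} :
    f ∈ filtration S u m a t (p + 1) ↔ f ∈ filtration S u m a t p ∧
      (p ∈ S → f ∈ pointIdeal (u p) ^ (t + 1 - a p)) := by
  refine ⟨fun h => ⟨filtration_succ_le _ h, fun hp => by simpa using (mem_filtration.1 h).2 p hp⟩,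
    fun ⟨h, hp⟩ => mem_filtration.2 ⟨(mem_filtration.1 h).1, fun q hq => ?_⟩⟩
  rcases eq_or_ne q p with rfl | hqp
  · simpa using hp hq
  · have := (mem_filtration.1 h).2 q hq
    have hne : (q : ℕ) ≠ p := fun h => hqp (Fin.ext h)
    have : ((q : ℕ) < p + 1) ↔ (q : ℕ) < p := by omega
    simpa only [this]

/-- The number of new linear conditions imposed at the step `(t, p)` of the filtration. -/
noncomputable def jump (S : Set (Fin N)) (u : Fin N → σ → F) (m : ℕ) (a : Fin N → ℕ)
    (t : ℕ) (p : Fin N) : ℕ :=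
  Module.finrank F (filtration S u m a t p) - Module.finrank F (filtration S u m a t (p + 1))

/-- The total number of linear conditions contributed by the point `p` before time `R`. -/
noncomputable def contribution (S : Set (Fin N)) (u : Fin N → σ → F) (m : ℕ) (R : ℕ)
    (a : Fin N → ℕ) (p : Fin N) : ℕ :=
  ∑ t ∈ Finset.range R, jump S u m a t p

lemma sum_jump (t : ℕ) :
    ∑ p, jump S u m a t p + Module.finrank F (filtration S u m a (t + 1) 0) =
      Module.finrank F (filtration S u m a t 0) := by
  have hN : filtration S u m a (t + 1) 0 = filtration S u m a t N := by
    ext f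
    simp [mem_filtration]
  have key : ∀ i : ℕ, ∑ p ∈ Finset.range i, (Module.finrank F (filtration S u m a t p) -
      Module.finrank F (filtration S u m a t (p + 1))) + Module.finrank F (filtration S u m a t i)
      = Module.finrank F (filtration S u m a t 0) := by
    intro i
    induction i with
    | zero => simp
    | succ i ih =>
      have := Submodule.finrank_mono (filtration_succ_le (S := S) (u := u) (m := m) (a := a)
        (t := t) i)
      rw [Finset.sum_range_succ]
      omega
  rw [hN, ← key N, Finset.sum_range fun p => Module.finrank F (filtration S u m a t p) -
      Module.finrank F (filtration S u m a t (p + 1))]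
  rfl

lemma sum_contribution (R : ℕ) :
    ∑ p, contribution S u m R a p + Module.finrank F (filtration S u m a R 0) =
      Module.finrank F (restrictTotalDegree σ F m) := by
  induction R with
  | zero =>
    have : filtration S u m a 0 0 = restrictTotalDegree σ F m := by
      ext f
      simp [mem_filtration, mem_restrictTotalDegree]
    rw [this]
    simp [contribution]
  | succ R ih =>
    have h := sum_jump (S := S) (u := u) (m := m) (a := a) R
    simp only [contribution, Finset.sum_range_succ, Finset.sum_add_distrib] at ih ⊢
    omega

lemma sum_contribution_le (R : ℕ) :
    ∑ p, contribution S u m R a p ≤ Module.finrank F (restrictTotalDegree σ F m) := by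
  have := sum_contribution (S := S) (u := u) (m := m) (a := a) R
  omega

omit [Fintype σ] in
lemma filtration_eq_bot {R : ℕ} {q : Fin N} (hq : q ∈ S) (hR : a q + m < R) (i : ℕ) :
    filtration S u m a R i = ⊥ := by
  rw [eq_bot_iff]
  intro f hf
  rw [mem_filtration] at hf
  exact eq_zero_of_mem_pointIdeal_pow (hf.2 q hq) (by have := hf.1; split_ifs <;> omega)

lemma sum_contribution_eq {R : ℕ} {q : Fin N} (hq : q ∈ S) (hR : a q + m < R) :
    ∑ p, contribution S u m R a p = Module.finrank F (restrictTotalDegree σ F m) := by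
  rw [← sum_contribution (S := S) (u := u) (m := m) (a := a) R, filtration_eq_bot hq hR,
    finrank_bot, add_zero]

omit [Fintype σ] in
lemma contribution_eq_zero {R : ℕ} {p : Fin N} (hp : p ∉ S) :
    contribution S u m R a p = 0 := by
  refine Finset.sum_eq_zero fun t _ => ?_
  have : filtration S u m a t (p + 1) = filtration S u m a t p := by
    ext f
    simp [mem_filtration_succ, hp]
  rw [jump, this, Nat.sub_self]

lemma contribution_mono_degree {R m' : ℕ} (hm : m' ≤ m) (q : Fin N) :
    contribution S u m' R a q ≤ contribution S u m R a q := by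
  refine Finset.sum_le_sum fun t _ => finrank_sub_finrank_le LinearMap.id (filtration_succ_le _)
    (filtration_succ_le _) (fun f hf => ?_) (fun f hf hf' => ?_)
  · rw [mem_filtration] at hf
    exact mem_filtration.2 ⟨hf.1.trans hm, hf.2⟩
  · exact mem_filtration_succ.2 ⟨hf, (mem_filtration_succ.1 hf').2⟩

lemma contribution_mono_delay {R : ℕ} {a' : Fin N → ℕ} (h : a' ≤ a) {q : Fin N}
    (hq : a' q = a q) : contribution S u m R a' q ≤ contribution S u m R a q := by
  refine Finset.sum_le_sum fun t _ => finrank_sub_finrank_le LinearMap.id (filtration_succ_le _)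
    (filtration_succ_le _) (fun f hf => ?_) (fun f hf hf' => ?_)
  · rw [mem_filtration] at hf
    exact mem_filtration.2 ⟨hf.1, fun q hq => Ideal.pow_le_pow_right
      (Nat.sub_le_sub_left (h q) _) (hf.2 q hq)⟩
  · exact mem_filtration_succ.2 ⟨hf, by
      simpa only [hq, LinearMap.id_apply] using (mem_filtration_succ.1 hf').2⟩

omit [Fintype σ] in
lemma exists_separating_linear {x y : σ → F} (h : x ≠ y) :
    ∃ l : MvPolynomial σ F, l.totalDegree ≤ 1 ∧ eval x l = 0 ∧ eval y l ≠ 0 := by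
  obtain ⟨i, hi⟩ := Function.ne_iff.1 h
  refine ⟨X i + C (-x i), totalDegree_X_add_C_le _ _, by simp, ?_⟩
  simpa [← sub_eq_add_neg, sub_eq_zero] using hi.symm

lemma jump_shift_le {m' : ℕ} (hm : m' + N ≤ m) {p : Fin N} (hp : p ∈ S)
    (hu : ∀ q ∈ S, u q = u p → q = p) {a' : Fin N → ℕ} (hap : a p = a' p + 1)
    (ha : ∀ q ≠ p, a q = a' q) (t : ℕ) : jump S u m' a' t p ≤ jump S u m a (t + 1) p := by
  classical
  have hl : ∀ q : Fin N, ∃ l : MvPolynomial σ F, l.totalDegree ≤ 1 ∧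
      (q ∈ S → q ≠ p → eval (u q) l = 0) ∧ eval (u p) l ≠ 0 := by
    intro q
    by_cases hq : q ∈ S ∧ q ≠ p
    · obtain ⟨l, h1, h2, h3⟩ := exists_separating_linear fun h => hq.2 (hu q hq.1 h)
      exact ⟨l, h1, fun _ _ => h2, h3⟩
    · exact ⟨1, by simp, fun h1 h2 => absurd ⟨h1, h2⟩ hq, by simp⟩
  choose l hl1 hl2 hl3 using hl
  have hQ : eval (u p) (∏ q, l q) ≠ 0 := by
    rw [map_prod]
    exact Finset.prod_ne_zero_iff.2 fun q _ => hl3 q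
  have hQd : (∏ q, l q).totalDegree ≤ N :=
    (totalDegree_finsetProd _ _).trans
      ((Finset.sum_le_sum fun q _ => hl1 q).trans (by simp))
  refine finrank_sub_finrank_le (LinearMap.mulLeft F (∏ q, l q)) (filtration_succ_le _)
    (filtration_succ_le _) (fun f hf => ?_) (fun f hf hf' => ?_)
  · rw [mem_filtration] at hf
    refine mem_filtration.2 ⟨?_, fun q hq => ?_⟩
    · exact (totalDegree_mul _ _).trans (by have := hf.1; omega)
    · have hfq := hf.2 q hq
      rw [LinearMap.mulLeft_apply]
      rcases eq_or_ne q p with rfl | hqp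
      · refine Ideal.pow_le_pow_right ?_ (Ideal.mul_mem_left _ _ hfq)
        simp only [lt_irrefl, if_false]
        omega
      · have h1 : ∏ q, l q ∈ pointIdeal (u q) := by
          apply mem_pointIdeal_of_eval_eq_zero
          rw [map_prod]
          exact Finset.prod_eq_zero (Finset.mem_univ q) (hl2 q hq hqp)
        have h2 := Ideal.mul_mem_mul h1 hfq
        rw [← pow_succ'] at h2
        refine Ideal.pow_le_pow_right ?_ h2
        rw [ha q hqp]
        omega
  · refine mem_filtration_succ.2 ⟨hf, fun _ => ?_⟩
    have h1 := (mem_filtration_succ.1 hf').2 hp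
    rw [LinearMap.mulLeft_apply] at h1
    have h2 := mem_pointIdeal_pow_of_mul_mem hQ h1
    rwa [hap, Nat.add_sub_add_right] at h2

lemma contribution_le_add {m' R : ℕ} (hm : m' + N ≤ m) {p : Fin N}
    (hu : p ∈ S → ∀ q ∈ S, u q = u p → q = p) {a' : Fin N → ℕ} (hap : a p = a' p + 1)
    (ha : ∀ q ≠ p, a q = a' q) (hR : a p + m < R) :
    contribution S u m R a' p ≤ contribution S u m R a p +
      (Module.finrank F (restrictTotalDegree σ F m) -
        Module.finrank F (restrictTotalDegree σ F m')) := by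
  by_cases hp : p ∈ S
  · have h1 : contribution S u m' R a' p ≤ contribution S u m R a p := by
      have hlast : jump S u m a R p = 0 := by
        rw [jump, filtration_eq_bot hp hR, finrank_bot, Nat.zero_sub]
      have : contribution S u m R a p = contribution S u m (R + 1) a p := by
        rw [contribution, contribution, Finset.sum_range_succ, hlast, add_zero]
      rw [this, contribution, contribution, Finset.sum_range_succ']
      exact (Finset.sum_le_sum fun t _ => jump_shift_le hm hp (hu hp) hap ha t).trans
        (Nat.le_add_right _ _)
    have h2 := sum_contribution_eq (u := u) (m := m) (a := a') (R := R) hp (by omega)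
    have h3 := sum_contribution_eq (u := u) (m := m') (a := a') (R := R) hp (by omega)
    have h4 : ∀ q, contribution S u m' R a' q ≤ contribution S u m R a' q :=
      contribution_mono_degree (by omega)
    rw [← Finset.add_sum_erase _ _ (Finset.mem_univ p)] at h2 h3
    have h5 := Finset.sum_le_sum fun q (_ : q ∈ Finset.univ.erase p) => h4 q
    have h6 := h4 p
    omega
  · rw [contribution_eq_zero hp]
    exact Nat.zero_le _

lemma exists_separating_functionals {R : ℕ} {p : Fin N} (hp : p ∈ S) (hR : a p + m < R) :
    ∃ (κ : Type) (_ : Fintype κ) (θ : κ → MvPolynomial σ F →ₗ[F] F) (deg : κ → ℕ),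
      Fintype.card κ ≤ contribution S u m R a p ∧
      (∀ s, IsHomogeneousFunctional (θ s) (deg s)) ∧
      ∀ r ≤ m, ∀ w ∈ filtration S u m a (a p + r) p,
        (∀ s, θ s (homogeneousComponent r (translate (u p) w)) = 0) →
        homogeneousComponent r (translate (u p) w) = 0 := by
  classical
  let f : ℕ → MvPolynomial σ F →ₗ[F] MvPolynomial σ F := fun r =>
    (homogeneousComponent r).comp (translate (u p)).toLinearMap
  let L : ℕ → Submodule F (MvPolynomial σ F) := fun r => (filtration S u m a (a p + r) p).map (f r)
  have hLfin : ∀ r, FiniteDimensional F (L r) := fun r => inferInstance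
  have hL : ∀ r, Module.finrank F (L r) ≤ jump S u m a (a p + r) p := by
    refine fun r => finrank_map_le_sub (f r) (filtration_succ_le _) fun x hx => ?_
    have := (mem_filtration_succ.1 hx).2 hp
    rw [show a p + r + 1 - a p = r + 1 by omega] at this
    exact homogeneousComponent_translate_eq_zero this
  choose g hg using fun r => (L r).subtype.exists_leftInverse_of_injective (L r).ker_subtype
  refine ⟨Σ r : Fin (m + 1), Fin (Module.finrank F (L r)), inferInstance,
    fun s => ((Module.finBasis F (L s.1)).coord s.2).comp
      ((g s.1).comp (homogeneousComponent (s.1 : ℕ))), fun s => s.1, ?_, ?_, ?_⟩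
  · rw [Fintype.card_sigma]
    simp only [Fintype.card_fin]
    rw [← Finset.sum_range fun r => Module.finrank F (L r)]
    refine (Finset.sum_le_sum fun r _ => hL r).trans ?_
    rw [contribution, Finset.range_eq_Ico, Finset.sum_Ico_add (fun t => jump S u m a t p) 0 (m + 1)
      (a p)]
    refine Finset.sum_le_sum_of_subset fun x hx => ?_
    simp only [Finset.mem_Ico, Finset.mem_range] at hx ⊢
    omega
  · intro s e he
    simp [homogeneousComponent_monomial_one, he]
  · intro r hr w hw h
    have hmem : f r w ∈ L r := Submodule.mem_map_of_mem hw
    have hid : homogeneousComponent r (f r w) = f r w :=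
      homogeneousComponent_eq_self (homogeneousComponent_isHomogeneous _ _)
    have hzero : (⟨f r w, hmem⟩ : L r) = 0 := by
      refine (Module.finBasis F (L r)).ext_elem fun i => ?_
      have h1 := h ⟨⟨r, Nat.lt_succ_of_le hr⟩, i⟩
      have h2 : g r (f r w) = ⟨f r w, hmem⟩ := DFunLike.congr_fun (hg r) ⟨f r w, hmem⟩
      change (Module.finBasis F (L r)).coord i (g r (homogeneousComponent r (f r w))) = 0 at h1
      rw [hid, h2] at h1
      simpa using h1
    exact congrArg Subtype.val hzero

end Filtration

end Multijoint

namespace Multijoint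

open MvPolynomial

section AffineSubstitution

variable {F : Type*} [Field F] {σ τ υ : Type*} [Fintype σ] [Fintype τ] [Fintype υ]

/-- The coordinates of the affine map `y ↦ x + T y`, as polynomials. -/
noncomputable def affinePoly [DecidableEq τ] (T : (τ → F) →ₗ[F] (σ → F)) (x : σ → F) (l : σ) :
    MvPolynomial τ F :=
  C (x l) + ∑ t, C (T (Pi.single t 1) l) * X t

variable [DecidableEq σ] [DecidableEq τ]

omit [Fintype σ] [DecidableEq σ] in
lemma sum_single_mul (T : (τ → F) →ₗ[F] (σ → F)) (y : τ → F) (l : σ) :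
    ∑ t, T (Pi.single t 1) l * y t = T y l := by
  conv_rhs => rw [pi_eq_sum_univ' y, map_sum, Finset.sum_apply]
  refine Finset.sum_congr rfl fun t _ => ?_
  rw [map_smul, Pi.smul_apply, smul_eq_mul, mul_comm]

omit [Fintype σ] [DecidableEq σ] in
lemma eval_affinePoly (T : (τ → F) →ₗ[F] (σ → F)) (x : σ → F) (y : τ → F) (l : σ) :
    eval y (affinePoly T x l) = x l + T y l := by
  simp [affinePoly, sum_single_mul]

omit [Fintype σ] [DecidableEq σ] in
lemma totalDegree_affinePoly_le (T : (τ → F) →ₗ[F] (σ → F)) (x : σ → F) (l : σ) :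
    (affinePoly T x l).totalDegree ≤ 1 := by
  refine (totalDegree_add _ _).trans (max_le (by simp) (totalDegree_finsetSum_le fun t _ => ?_))
  exact (totalDegree_mul _ _).trans (by simp)

lemma aeval_affinePoly_symm (T : (τ → F) ≃ₗ[F] (σ → F)) (x : σ → F) (f : MvPolynomial σ F) :
    aeval (affinePoly T.symm.toLinearMap (-T.symm x)) (aeval (affinePoly T.toLinearMap x) f) =
      f := by
  have : (aeval (affinePoly T.symm.toLinearMap (-T.symm x))).comp
      (aeval (affinePoly T.toLinearMap x)) = AlgHom.id F (MvPolynomial σ F) := by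
    ext l : 1
    have h1 : ∀ s, ∑ t, T (Pi.single t 1) l * T.symm (Pi.single s 1) t =
        Pi.single (M := fun _ => F) s 1 l := by
      intro s
      simpa using sum_single_mul T.toLinearMap (T.symm (Pi.single s 1)) l
    have h2 : ∑ t, T (Pi.single t 1) l * T.symm x t = x l := by
      simpa using sum_single_mul T.toLinearMap (T.symm x) l
    simp only [AlgHom.comp_apply, aeval_X, affinePoly, map_add, map_sum, map_mul, AlgHom.id_apply,
      algHom_C, algebraMap_eq, Finset.mul_sum, mul_add, Finset.sum_add_distrib, Pi.neg_apply,
      map_neg, mul_neg, Finset.sum_neg_distrib, LinearEquiv.coe_coe]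
    simp only [← mul_assoc, ← C_mul]
    rw [Finset.sum_comm, ← map_sum, h2]
    simp only [← Finset.sum_mul, ← map_sum, h1]
    simp [Pi.single_apply]
  exact DFunLike.congr_fun this f

lemma mem_pointIdeal_pow_of_aeval_affinePoly {T : (τ → F) ≃ₗ[F] (σ → F)} {x : σ → F}
    {f : MvPolynomial σ F} {s : ℕ}
    (h : aeval (affinePoly T.toLinearMap x) f ∈ pointIdeal (0 : τ → F) ^ s) :
    f ∈ pointIdeal x ^ s := by
  rw [← aeval_affinePoly_symm T x f]
  exact aeval_mem_pointIdeal_pow (fun i => by simp [eval_affinePoly]) h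

end AffineSubstitution

section Vanishing

variable {F : Type*} [Field F] {σ : Type*} [Fintype σ] [DecidableEq σ] {ι : Type*} [Fintype ι]
  [DecidableEq ι] {η : ι → Type*} [∀ i, Fintype (η i)] [∀ i, DecidableEq (η i)] {N : ℕ}

lemma finrank_le_sum_prod_contribution {pts : Fin N → σ → F} {I : Finset (Fin N)}
    (hI : I.Nonempty) {m R : ℕ} {a : Fin N → ℕ} (hR : ∀ p ∈ I, a p + m < R)
    (hgap : ∀ p ∈ I, ∀ q ∉ I, a p + m < a q)
    {S : Fin N → ι → Set (Fin N)} {u : Fin N → ∀ j, Fin N → η j → F}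
    {T : Fin N → ((Σ i, η i) → F) ≃ₗ[F] (σ → F)} (hS : ∀ p ∈ I, ∀ j, p ∈ S p j)
    (hT : ∀ p ∈ I, ∀ j, ∀ q ∈ S p j, ∃ y : (Σ i, η i) → F, pts q = pts p + T p y ∧
      (∀ i ≠ j, ∀ x, y ⟨i, x⟩ = 0) ∧ ∀ x, u p j q x = y ⟨j, x⟩ + u p j p x) :
    Module.finrank F (restrictTotalDegree σ F m) ≤
      ∑ p ∈ I, ∏ j, contribution (S p j) (u p j) m R a p := by
  classical
  by_contra! hlt
  choose κ hκ θ deg hcard hhom hsep using fun (p : I) (j : ι) =>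
    exists_separating_functionals (u := u p j) (hS p p.2 j) (hR p p.2)
  let L : restrictTotalDegree σ F m →ₗ[F] ((Σ p : I, ∀ j, κ p j) → F) :=
    LinearMap.pi fun s => (tensorFunctional fun j => θ s.1 j (s.2 j)).comp
      ((aeval (affinePoly (T s.1).toLinearMap (pts s.1))).toLinearMap.comp
        (Submodule.subtype _))
  have hL : LinearMap.ker L ≠ ⊥ := by
    refine LinearMap.ker_ne_bot_of_finrank_lt (lt_of_le_of_lt ?_ hlt)
    rw [Module.finrank_fintype_fun_eq_card, Fintype.card_sigma,
      ← Finset.sum_coe_sort I fun p => ∏ j, contribution (S p j) (u p j) m R a p]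
    refine Finset.sum_le_sum fun p _ => ?_
    rw [Fintype.card_pi]
    exact Finset.prod_le_prod' fun j _ => hcard p j
  obtain ⟨⟨g, hgm⟩, hgL, hg0⟩ := Submodule.exists_mem_ne_zero_of_ne_bot hL
  have hg0 : g ≠ 0 := fun h => hg0 (Subtype.ext h)
  rw [mem_restrictTotalDegree] at hgm
  have hgL : ∀ (p : I) (s : ∀ j, κ p j), tensorFunctional (fun j => θ p j (s j))
      (aeval (affinePoly (T p).toLinearMap (pts p)) g) = 0 := fun p s =>
    congrFun (LinearMap.mem_ker.1 hgL) ⟨p, s⟩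
  choose v hv hv' using fun q => exists_order hg0 (pts q)
  obtain ⟨p, hp, hmin⟩ := Finset.exists_min_image I (fun p => toLex (v p + a p, p)) hI
  have hvm : v p ≤ m := by
    by_contra! h
    exact hg0 (eq_zero_of_mem_pointIdeal_pow (hv p) (by omega))
  set f := aeval (affinePoly (T p).toLinearMap (pts p)) g with hf
  have hfm : f.totalDegree ≤ m :=
    (totalDegree_aeval_le (totalDegree_affinePoly_le _ _) g).trans hgm
  have hfv : f ∈ pointIdeal (0 : (Σ i, η i) → F) ^ v p :=
    aeval_mem_pointIdeal_pow (fun i => by rw [eval_affinePoly]; simp) (hv p)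
  have htr : translate (0 : (Σ i, η i) → F) f = f := by
    simp [translate]
  have hG : homogeneousComponent (v p) f ≠ 0 := by
    intro h0
    refine hv' p (mem_pointIdeal_pow_of_aeval_affinePoly (T := T p) ?_)
    rw [mem_pointIdeal_pow_iff] at hfv ⊢
    intro e he
    rcases Nat.lt_succ_iff_lt_or_eq.1 he with he | he
    · exact hfv e he
    · have := congrArg (coeff e) h0
      rw [coeff_homogeneousComponent, if_pos he, coeff_zero] at this
      rw [← hf, htr, this]
  refine hG (eq_zero_of_tensorFunctional_eq_zero (hhom ⟨p, hp⟩) (fun j ψ r hψ h => ?_) fun s =>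
    tensorFunctional_homogeneousComponent (fun i => hhom ⟨p, hp⟩ i (s i)) _ _ (hgL ⟨p, hp⟩ s))
  rw [contract_homogeneousComponent j hψ] at h ⊢
  split_ifs at h ⊢ with hle
  · set ρ := ∑ i ∈ Finset.univ.erase j, r i with hρ
    have hinv : translate (u p j p) (translate (-u p j p) (contract j ψ f)) = contract j ψ f :=
      translate_translate_of_add_eq_zero (add_neg_cancel _) _
    have := hsep ⟨p, hp⟩ j (v p - ρ) (by omega) (translate (-u p j p) (contract j ψ f))
      (mem_filtration.2 ⟨?_, fun q hq => ?_⟩)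
    · simp only [hinv] at this
      exact this h
    · exact (totalDegree_translate_le _ _).trans ((totalDegree_contract_le _ _ _).trans hfm)
    · by_cases hqI : q ∈ I
      · obtain ⟨y, hy1, hy2, hy3⟩ := hT p hp j q hq
        have h1 : f ∈ pointIdeal y ^ v q :=
          aeval_mem_pointIdeal_pow (fun i => by simp [eval_affinePoly, hy1]) (hv q)
        have h2 := contract_mem_pointIdeal_pow j hy2 (v q) f h1 ψ r hψ
        have h3 : translate (-u p j p) (contract j ψ f) ∈ pointIdeal (u p j q) ^ (v q - ρ) :=
          translate_mem_pointIdeal_pow (funext fun x => by simp [hy3]) h2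
        refine Ideal.pow_le_pow_right ?_ h3
        have := hmin q hqI
        simp only [Prod.Lex.toLex_le_toLex, Fin.le_def] at this
        dsimp only
        split_ifs <;> omega
      · have := hgap p hp q hqI
        have h0 : a p + (v p - ρ) + (if (q : ℕ) < p then 1 else 0) - a q = 0 := by
          split_ifs <;> omega
        dsimp only
        rw [h0]
        simp
  · rfl

end Vanishing

end Multijoint

namespace Multijoint

/-- Starting from constant delays, one lowers the delay of deficient points one step at a time;
the process cannot empty the mass of an isolated cluster of points. -/
lemma exists_delay {N m : ℕ} {Φ : (Fin N → ℕ) → Fin N → ℝ} {θ : Fin N → ℝ} {ε : ℝ}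
    (hmono : ∀ a, (∀ p, a p ≤ N * (m + 1)) → ∀ p, 0 < a p → ∀ q ≠ p,
      Φ (Function.update a p (a p - 1)) q ≤ Φ a q)
    (hlip : ∀ a, (∀ p, a p ≤ N * (m + 1)) → ∀ p, 0 < a p →
      Φ (Function.update a p (a p - 1)) p ≤ Φ a p + ε)
    (hmass : ∀ a, (∀ p, a p ≤ N * (m + 1)) → ∀ I : Finset (Fin N), I.Nonempty →
      (∀ p ∈ I, ∀ q ∉ I, a p + m < a q) → ∃ p ∈ I, θ p + ε < Φ a p) :
    ∃ a, (∀ p, a p ≤ N * (m + 1)) ∧ ∀ p, θ p ≤ Φ a p := by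
  let Q : (Fin N → ℕ) → Prop := fun a =>
    (∀ p, a p ≤ N * (m + 1)) ∧ ∀ p, a p < N * (m + 1) → Φ a p ≤ θ p + ε
  have hQ : ∃ s, ∃ a, Q a ∧ ∑ p, a p = s :=
    ⟨_, fun _ => N * (m + 1), ⟨fun _ => le_rfl, fun _ h => absurd h (lt_irrefl _)⟩, rfl⟩
  classical
  obtain ⟨a, ⟨ha, hinv⟩, hsum⟩ := Nat.find_spec hQ
  refine ⟨a, ha, fun p => ?_⟩
  by_contra! hp
  rcases Nat.eq_zero_or_pos (a p) with h0 | hpos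
  · have hgap : ∃ i < N, ∀ q, ¬ (i * (m + 1) < a q ∧ a q ≤ (i + 1) * (m + 1)) := by
      by_contra! h
      choose q hq using fun i : Fin N => h i i.2
      have hinj : Function.Injective q := by
        intro i j hij
        have hi := hq i
        have hj := hq j
        rw [← hij] at hj
        have h1 := lt_of_mul_lt_mul_right (hi.1.trans_le hj.2) (Nat.zero_le _)
        have h2 := lt_of_mul_lt_mul_right (hj.1.trans_le hi.2) (Nat.zero_le _)
        exact Fin.ext (by omega)
      obtain ⟨i, hi⟩ := Finite.surjective_of_injective hinj p
      have := (hq i).1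
      rw [hi, h0] at this
      omega
    obtain ⟨i, hiN, hi⟩ := hgap
    obtain ⟨p', hp', h⟩ := hmass a ha (Finset.univ.filter fun q => a q ≤ i * (m + 1))
      ⟨p, by simp [h0]⟩ fun p' hp' q hq => by
        simp only [Finset.mem_filter, Finset.mem_univ, true_and, not_le] at hp' hq
        have := hi q
        have h1 : (i + 1) * (m + 1) = i * (m + 1) + (m + 1) := by ring
        omega
    simp only [Finset.mem_filter, Finset.mem_univ, true_and] at hp'
    exact absurd (hinv p' (hp'.trans_lt (Nat.mul_lt_mul_of_pos_right hiN (Nat.succ_pos m))))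
      (not_le.2 h)
  · refine Nat.find_min hQ (m := ∑ q, Function.update a p (a p - 1) q) ?_
      ⟨_, ⟨fun q => ?_, fun q hq => ?_⟩, rfl⟩
    · rw [← hsum]
      refine Finset.sum_lt_sum (fun q _ => ?_) ⟨p, Finset.mem_univ p, ?_⟩
      · rcases eq_or_ne q p with rfl | hqp
        · simp
        · simp [hqp]
      · simpa using hpos
    · rcases eq_or_ne q p with rfl | hqp
      · simpa using (Nat.sub_le _ 1).trans (ha q)
      · simpa [hqp] using ha q
    · rcases eq_or_ne q p with rfl | hqp
      · exact (hlip a ha q hpos).trans (by linarith)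
      · rw [Function.update_of_ne hqp] at hq
        exact (hmono a ha p hpos q hqp).trans (hinv q hq)

end Multijoint

namespace Multijoint

open MvPolynomial

section Dimension

lemma finrank_restrictTotalDegree (F : Type*) [Field F] (k m : ℕ) :
    Module.finrank F (restrictTotalDegree (Fin k) F m) = (m + k).choose k := by
  classical
  have h1 : Module.finrank F (restrictTotalDegree (Fin k) F m) =
      Nat.card {e : Fin k →₀ ℕ | (e.sum fun _ i => i) ≤ m} :=
    Module.finrank_eq_nat_card_basis (basisRestrictSupport F _)
  have h2 : {e : Fin k →₀ ℕ | (e.sum fun _ i => i) ≤ m} =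
      ((Finset.range (m + 1)).biUnion fun i => Finset.finsuppAntidiag Finset.univ i :
        Finset (Fin k →₀ ℕ)) := by
    ext e
    simp [Finset.mem_finsuppAntidiag, Finsupp.sum_fintype]
  have h3 : ∀ m, ∑ i ∈ Finset.range (m + 1), k.multichoose i = (k + 1).multichoose m := by
    intro m
    induction m with
    | zero => simp
    | succ m ih => rw [Finset.sum_range_succ, ih, Nat.multichoose_succ_succ, add_comm]
  rw [h1, h2, Nat.card_coe_set_eq, Set.ncard_coe_finset, Finset.card_biUnion]
  · simp only [Finset.card_finsuppAntidiag_nat_eq_multichoose, Finset.card_univ, Fintype.card_fin]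
    rw [h3, Nat.multichoose_eq, show k + 1 + m - 1 = m + k by omega, Nat.choose_symm_add]
  · intro i _ j _ hij
    refine Finset.disjoint_left.2 fun e he he' => hij ?_
    rw [Finset.mem_finsuppAntidiag] at he he'
    exact he.1.symm.trans he'.1

lemma choose_add_le_pow (m k : ℕ) : (m + k).choose k ≤ (m + 1) ^ k := by
  induction k with
  | zero => simp
  | succ k ih =>
    have h := Nat.add_one_mul_choose_eq (m + k) k
    refine Nat.le_of_mul_le_mul_right (c := k + 1) ?_ (Nat.succ_pos k)
    calc (m + (k + 1)).choose (k + 1) * (k + 1) = (m + k + 1) * (m + k).choose k := h.symm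
      _ ≤ ((m + 1) * (k + 1)) * (m + 1) ^ k := Nat.mul_le_mul (by nlinarith) ih
      _ = (m + 1) ^ (k + 1) * (k + 1) := by ring

lemma prod_choose_le {ι : Type*} [Fintype ι] (k : ι → ℕ) (m : ℕ) :
    ∏ j, (m + k j).choose (k j) ≤ (∑ j, k j).factorial * (m + ∑ j, k j).choose (∑ j, k j) := by
  rw [← Nat.ascFactorial_eq_factorial_mul_choose]
  refine le_trans ?_ (Nat.pow_succ_le_ascFactorial _ _)
  rw [← Finset.prod_pow_eq_pow_sum]
  exact Finset.prod_le_prod' fun j _ => choose_add_le_pow m (k j)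

lemma choose_add_add_le (M N k : ℕ) :
    (M + N + k + 1).choose (k + 1) ≤ (M + k + 1).choose (k + 1) + N * (M + N + k).choose k := by
  induction N with
  | zero => simp
  | succ N ih =>
    have h1 : (M + (N + 1) + k + 1).choose (k + 1) =
        (M + N + 1 + k).choose k + (M + N + k + 1).choose (k + 1) := by
      rw [Nat.choose_succ_succ]
      congr 2
      ring
    have h2 : (M + N + k).choose k ≤ (M + N + 1 + k).choose k := Nat.choose_le_choose _ (by omega)
    rw [h1, ← add_assoc M N 1]
    nlinarith

lemma choose_sub_choose_le {n k M N : ℕ} (hk : 0 < k) (hkn : k ≤ n) :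
    (((M + N + k).choose k - (M + k).choose k : ℕ) : ℝ) ≤
      N * n / (M + N + 1) * (M + N + k).choose k := by
  obtain ⟨k, rfl⟩ := Nat.exists_eq_succ_of_ne_zero hk.ne'
  have h1 : (M + N + (k + 1)).choose (k + 1) - (M + (k + 1)).choose (k + 1) ≤
      N * (M + N + k).choose k := by
    have := choose_add_add_le M N k
    simp only [← add_assoc]
    omega
  have h2 : (M + N + 1) * (M + N + k).choose k ≤ n * (M + N + (k + 1)).choose (k + 1) := by
    calc (M + N + 1) * (M + N + k).choose k ≤ (M + N + k + 1) * (M + N + k).choose k :=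
          Nat.mul_le_mul_right _ (by omega)
      _ = (M + N + k + 1).choose (k + 1) * (k + 1) := Nat.add_one_mul_choose_eq _ _
      _ ≤ (M + N + k + 1).choose (k + 1) * n := Nat.mul_le_mul_left _ hkn
      _ = _ := mul_comm _ _
  have h3 : ((M : ℝ) + N + 1) * (M + N + k).choose k ≤
      n * (M + N + (k + 1)).choose (k + 1) := by exact_mod_cast h2
  have h4 : (((M + N + (k + 1)).choose (k + 1) - (M + (k + 1)).choose (k + 1) : ℕ) : ℝ) ≤
      N * (M + N + k).choose k := by exact_mod_cast h1
  refine h4.trans ?_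
  rw [div_mul_eq_mul_div, le_div_iff₀ (by positivity)]
  have hN : (0 : ℝ) ≤ N := Nat.cast_nonneg N
  nlinarith

end Dimension

section Product

lemma prod_le_prod_add {ι : Type*} (s : Finset ι) {x y : ι → ℝ} {η : ℝ} (hη : 0 ≤ η)
    (hx : ∀ j ∈ s, 0 ≤ x j) (hy : ∀ j ∈ s, 0 ≤ y j) (hx1 : ∀ j ∈ s, x j ≤ 1)
    (hy1 : ∀ j ∈ s, y j ≤ 1) (hxy : ∀ j ∈ s, x j ≤ y j + η) :
    ∏ j ∈ s, x j ≤ ∏ j ∈ s, y j + s.card * η := by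
  classical
  induction s using Finset.induction_on with
  | empty => simp
  | insert i s hi ih =>
    rw [Finset.prod_insert hi, Finset.prod_insert hi, Finset.card_insert_of_notMem hi]
    simp only [Finset.mem_insert, forall_eq_or_imp] at hx hy hx1 hy1 hxy
    have h := ih hx.2 hy.2 hx1.2 hy1.2 hxy.2
    have h1 : ∏ j ∈ s, x j ≤ 1 := Finset.prod_le_one hx.2 hx1.2
    have h2 : 0 ≤ ∏ j ∈ s, x j := Finset.prod_nonneg hx.2
    have h3 : x i * ∏ j ∈ s, x j ≤ (y i + η) * ∏ j ∈ s, x j :=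
      mul_le_mul_of_nonneg_right hxy.1 h2
    have h4 : y i * ∏ j ∈ s, x j ≤ y i * (∏ j ∈ s, y j + s.card * η) :=
      mul_le_mul_of_nonneg_left h hy.1
    have h5 : η * ∏ j ∈ s, x j ≤ η := mul_le_of_le_one_right hη h1
    have h6 : y i * (s.card * η) ≤ s.card * η := mul_le_of_le_one_left (by positivity) hy1.1
    push_cast
    nlinarith

end Product

end Multijoint

namespace Multijoint

open MvPolynomial

section Geometry

variable {F : Type*} [Field F]

lemma exists_chart {V : Type*} [AddCommGroup V] [Module F V] {N k : ℕ} (pts : Fin N → V)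
    {π : AffineSubspace F V} (hne : (π : Set V).Nonempty) (hk : 0 < k)
    (hrank : Module.finrank F π.direction = k) :
    ∃ (M : (Fin k → F) →ₗ[F] V) (u : Fin N → Fin k → F), LinearMap.range M = π.direction ∧
      ∀ p q, pts p ∈ π → pts q ∈ π → pts q = pts p + M (u q - u p) := by
  classical
  have : FiniteDimensional F π.direction := Module.finite_of_finrank_pos (by omega)
  obtain ⟨x₀, hx₀⟩ := hne
  let e : (Fin k → F) ≃ₗ[F] π.direction := LinearEquiv.ofFinrankEq _ _ (by simp [hrank])
  refine ⟨π.direction.subtype.comp e.toLinearMap, fun q => if h : pts q ∈ π then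
    e.symm ⟨pts q - x₀, AffineSubspace.vsub_mem_direction h hx₀⟩ else 0, ?_, fun p q hp hq => ?_⟩
  · rw [LinearMap.range_comp, LinearEquiv.range, Submodule.map_top, Submodule.range_subtype]
  · simp [hp, hq]

lemma exists_linearEquiv_of_iSup_range_eq_top {ι σ : Type*} [Fintype ι] [Fintype σ]
    [DecidableEq ι] {η : ι → Type*} [∀ i, Fintype (η i)]
    (hcard : ∑ i, Fintype.card (η i) = Fintype.card σ)
    (M : ∀ i, (η i → F) →ₗ[F] (σ → F)) (hM : ⨆ i, LinearMap.range (M i) = ⊤) :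
    ∃ T : ((Σ i, η i) → F) ≃ₗ[F] (σ → F),
      ∀ j v, T (fun s => Pi.single (M := fun i => η i → F) j v s.1 s.2) = M j v := by
  let T : ((Σ i, η i) → F) →ₗ[F] (σ → F) :=
    ∑ i, (M i).comp (LinearMap.funLeft F F (Sigma.mk i))
  have hT : ∀ j v, T (fun s => Pi.single (M := fun i => η i → F) j v s.1 s.2) = M j v := by
    intro j v
    rw [LinearMap.sum_apply, Finset.sum_eq_single j]
    · rw [LinearMap.comp_apply]
      congr 1
      ext x
      simp [LinearMap.funLeft_apply]
    · intro i _ hij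
      rw [LinearMap.comp_apply]
      convert map_zero (M i)
      ext x
      simp [LinearMap.funLeft_apply, hij]
    · simp
  have hsurj : Function.Surjective T := by
    rw [← LinearMap.range_eq_top, eq_top_iff, ← hM]
    refine iSup_le fun j => ?_
    rintro _ ⟨v, rfl⟩
    exact ⟨_, hT j v⟩
  have hinj : Function.Injective T :=
    (LinearMap.injective_iff_surjective_of_finrank_eq_finrank (by simp [hcard])).2 hsurj
  exact ⟨LinearEquiv.ofBijective T ⟨hinj, hsurj⟩, hT⟩

end Geometry

section Weights

/-- The planes `τ j` all pass through `x`, and their directions span the whole space. -/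
def Transverse {F : Type*} [Field F] {V : Type*} [AddCommGroup V] [Module F V] {ι : Type*}
    (x : V) (τ : ι → AffineSubspace F V) : Prop :=
  (∀ j, x ∈ τ j) ∧ (⨆ j, (τ j).direction) = ⊤

lemma one_le_factorial_mul_sum {F : Type*} [Field F] {n N : ℕ} {ι : Type*} [Fintype ι]
    [DecidableEq ι] {k : ι → ℕ} (hsum : ∑ j, k j = n) {pts : Fin N → Fin n → F}
    {τ : Fin N → ι → AffineSubspace F (Fin n → F)} (hτ : ∀ p, Transverse (pts p) (τ p))
    {M : ∀ j, AffineSubspace F (Fin n → F) → (Fin (k j) → F) →ₗ[F] (Fin n → F)}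
    {u : ∀ j, AffineSubspace F (Fin n → F) → Fin N → Fin (k j) → F}
    (hM : ∀ p j, LinearMap.range (M j (τ p j)) = (τ p j).direction)
    (hu : ∀ p j q, pts q ∈ τ p j →
      pts q = pts p + M j (τ p j) (u j (τ p j) q - u j (τ p j) p))
    {I : Finset (Fin N)} (hI : I.Nonempty) {m R : ℕ} {a : Fin N → ℕ}
    (hR : ∀ p ∈ I, a p + m < R) (hgap : ∀ p ∈ I, ∀ q ∉ I, a p + m < a q) :
    (1 : ℝ) ≤ n.factorial * ∑ p ∈ I, ∏ j,
      ((contribution {q | pts q ∈ τ p j} (u j (τ p j)) m R a p : ℝ) /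
        (m + k j).choose (k j)) := by
  choose T hT using fun p => exists_linearEquiv_of_iSup_range_eq_top (by simp [hsum])
    (fun j => M j (τ p j)) (by simp only [hM]; exact (hτ p).2)
  have key := finrank_le_sum_prod_contribution (pts := pts) hI hR hgap
    (S := fun p j => {q | pts q ∈ τ p j}) (u := fun p j => u j (τ p j)) (T := T)
    (fun p _ j => (hτ p).1 j) (fun p _ j q hq =>
      ⟨fun s => Pi.single (M := fun i => Fin (k i) → F) j
        (u j (τ p j) q - u j (τ p j) p) s.1 s.2,
      by rw [hT]; exact hu p j q hq, fun i hij x => by simp [hij], fun x => by simp⟩)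
  rw [finrank_restrictTotalDegree] at key
  have hprod := prod_choose_le k m
  rw [hsum] at hprod
  have hpos : (0 : ℝ) < ∏ j, ((m + k j).choose (k j) : ℝ) :=
    Finset.prod_pos fun j _ => by exact_mod_cast Nat.choose_pos (by omega)
  have hpos' : (0 : ℝ) < (m + n).choose n := by exact_mod_cast Nat.choose_pos (by omega)
  have key' : ((m + n).choose n : ℝ) ≤ ∑ p ∈ I, ∏ j,
      (contribution {q | pts q ∈ τ p j} (u j (τ p j)) m R a p : ℝ) := by exact_mod_cast key
  have hprod' : ∏ j, ((m + k j).choose (k j) : ℝ) ≤ n.factorial * (m + n).choose n := by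
    exact_mod_cast hprod
  simp only [Finset.prod_div_distrib, ← Finset.sum_div]
  rw [← mul_div_assoc, le_div_iff₀ hpos, one_mul]
  exact hprod'.trans (mul_le_mul_of_nonneg_left key' (Nat.cast_nonneg _))

theorem exists_weights {F : Type*} [Field F] {n N : ℕ} {ι : Type*} [Fintype ι] [DecidableEq ι]
    {k : ι → ℕ} (hk : ∀ j, 0 < k j) (hsum : ∑ j, k j = n)
    (P : ι → Finset (AffineSubspace F (Fin n → F)))
    (hP : ∀ j, ∀ π ∈ P j, (π : Set (Fin n → F)).Nonempty ∧ Module.finrank F π.direction = k j)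
    {pts : Fin N → Fin n → F} (hpts : Function.Injective pts) {w : Fin N → ℝ} (hw : ∀ p, 0 ≤ w p)
    (hw1 : ∑ p, w p = 1) (htrans : ∀ p, ∃ τ ∈ Fintype.piFinset P, Transverse (pts p) τ) :
    ∃ β : ι → AffineSubspace F (Fin n → F) → Fin N → ℝ, (∀ j π p, 0 ≤ β j π p) ∧
      (∀ j π, ∑ p, β j π p ≤ 1) ∧
      ∀ p, ∀ τ ∈ Fintype.piFinset P, Transverse (pts p) τ →
        (2 * n.factorial : ℝ)⁻¹ * w p ≤ ∏ j, β j (τ j) p := by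
  classical
  have hchart : ∀ j (π : AffineSubspace F (Fin n → F)),
      ∃ (M : (Fin (k j) → F) →ₗ[F] (Fin n → F)) (u : Fin N → Fin (k j) → F), π ∈ P j →
        LinearMap.range M = π.direction ∧
        ∀ p q, pts p ∈ π → pts q ∈ π → pts q = pts p + M (u q - u p) := by
    intro j π
    by_cases h : π ∈ P j
    · obtain ⟨M, u, h'⟩ := exists_chart pts (hP j π h).1 (hk j) (hP j π h).2
      exact ⟨M, u, fun _ => h'⟩
    · exact ⟨0, 0, fun h' => absurd h' h⟩
  choose M u hMu using hchart
  have hkn : ∀ j, k j ≤ n := fun j => hsum ▸ Finset.single_le_sum (fun i _ => Nat.zero_le (k i))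
    (Finset.mem_univ j)
  set c : ℝ := (2 * n.factorial : ℝ)⁻¹ with hc
  have hfac : (0 : ℝ) < n.factorial := by exact_mod_cast n.factorial_pos
  have hcpos : 0 < c := by positivity
  obtain ⟨L, hL⟩ := exists_nat_gt ((N * (Fintype.card ι * (N * n)) : ℝ) / c)
  set m := L + N with hm
  set η : ℝ := N * n / (L + N + 1) with hη
  have hη0 : 0 ≤ η := by positivity
  set ε : ℝ := Fintype.card ι * η with hε
  have hNε : N * ε < c := by
    rw [hε, hη, ← mul_div_assoc, ← mul_div_assoc, div_lt_iff₀ (by positivity)]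
    rw [div_lt_iff₀ hcpos] at hL
    have : (0 : ℝ) ≤ N := Nat.cast_nonneg N
    nlinarith
  set R := N * (m + 1) + m + 1 with hR
  let B : (Fin N → ℕ) → ∀ j, AffineSubspace F (Fin n → F) → Fin N → ℝ := fun a j π p =>
    (contribution {q | pts q ∈ π} (u j π) m R a p : ℝ) / (m + k j).choose (k j)
  have hDpos : ∀ j, (0 : ℝ) < (m + k j).choose (k j) := fun j => by
    exact_mod_cast Nat.choose_pos (by omega)
  have hB0 : ∀ a j π p, 0 ≤ B a j π p := fun a j π p => by positivity
  have hBsum : ∀ a j π, ∑ p, B a j π p ≤ 1 := by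
    intro a j π
    rw [← Finset.sum_div, div_le_one (hDpos j)]
    have := sum_contribution_le (S := {q | pts q ∈ π}) (u := u j π) (m := m) (a := a) R
    rw [finrank_restrictTotalDegree] at this
    exact_mod_cast this
  have hB1 : ∀ a j π p, B a j π p ≤ 1 := fun a j π p =>
    (Finset.single_le_sum (fun q _ => hB0 a j π q) (Finset.mem_univ p)).trans (hBsum a j π)
  let K : Fin N → Finset (ι → AffineSubspace F (Fin n → F)) := fun p =>
    (Fintype.piFinset P).filter fun τ => Transverse (pts p) τ
  have hK : ∀ p, (K p).Nonempty := fun p =>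
    let ⟨τ, h1, h2⟩ := htrans p
    ⟨τ, Finset.mem_filter.2 ⟨h1, h2⟩⟩
  let Φ : (Fin N → ℕ) → Fin N → ℝ := fun a p => (K p).inf' (hK p) fun τ => ∏ j, B a j (τ j) p
  have hΦ : ∀ a p, ∃ τ ∈ K p, Φ a p = ∏ j, B a j (τ j) p := fun a p =>
    Finset.exists_mem_eq_inf' (hK p) _
  have hΦle : ∀ a p, ∀ τ ∈ K p, Φ a p ≤ ∏ j, B a j (τ j) p := fun a p τ hτ =>
    Finset.inf'_le _ hτ
  have hup : ∀ (a : Fin N → ℕ) p, Function.update a p (a p - 1) ≤ a := by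
    intro a p q
    rcases eq_or_ne q p with rfl | h
    · simp
    · simp [h]
  suffices h : ∃ a, (∀ p, a p ≤ N * (m + 1)) ∧ ∀ p, c * w p ≤ Φ a p by
    obtain ⟨a, -, ha⟩ := h
    exact ⟨B a, hB0 a, hBsum a, fun p τ hτ h =>
      (ha p).trans (hΦle a p τ (Finset.mem_filter.2 ⟨hτ, h⟩))⟩
  refine exists_delay (ε := ε) ?_ ?_ ?_
  · intro a _ p _ q hqp
    obtain ⟨τ, hτ, h⟩ := hΦ a q
    rw [h]
    refine (hΦle _ _ τ hτ).trans (Finset.prod_le_prod (fun j _ => hB0 _ _ _ _) fun j _ => ?_)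
    refine div_le_div_of_nonneg_right ?_ (hDpos j).le
    exact_mod_cast contribution_mono_delay (hup a p) (Function.update_of_ne hqp _ _)
  · intro a haA p hp
    obtain ⟨τ, hτ, h⟩ := hΦ a p
    rw [h]
    refine (hΦle _ _ τ hτ).trans ((prod_le_prod_add Finset.univ hη0 (fun j _ => hB0 _ _ _ _)
      (fun j _ => hB0 _ _ _ _) (fun j _ => hB1 _ _ _ _) (fun j _ => hB1 _ _ _ _)
      fun j _ => ?_).trans_eq rfl)
    have hτj := hMu j (τ j) (Fintype.mem_piFinset.1 (Finset.mem_filter.1 hτ).1 j)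
    have h1 := contribution_le_add (S := {q | pts q ∈ τ j}) (u := u j (τ j)) (m := m) (m' := L)
      (R := R) (a := a) (a' := Function.update a p (a p - 1)) le_rfl (p := p)
      (fun hpS q hqS huq => hpts (by
        have := hτj.2 p q hpS hqS
        rwa [huq, sub_self, map_zero, add_zero] at this))
      (by rw [Function.update_self]; omega) (fun q hq => (Function.update_of_ne hq _ _).symm)
      (by have := haA p; omega)
    rw [finrank_restrictTotalDegree, finrank_restrictTotalDegree] at h1
    have h2 := choose_sub_choose_le (M := L) (N := N) (hk j) (hkn j)
    have h3 : (contribution {q | pts q ∈ τ j} (u j (τ j)) m R (Function.update a p (a p - 1)) p : ℝ)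
        ≤ contribution {q | pts q ∈ τ j} (u j (τ j)) m R a p +
          ((m + k j).choose (k j) - (L + k j).choose (k j) : ℕ) := by exact_mod_cast h1
    rw [div_le_iff₀ (hDpos j), add_mul, div_mul_cancel₀ _ (hDpos j).ne']
    exact h3.trans (add_le_add_right h2 _)
  · intro a haA I hI hgap
    by_contra! hlt
    choose τ hτ hτΦ using hΦ a
    have hmem : ∀ p j, τ p j ∈ P j := fun p j =>
      Fintype.mem_piFinset.1 (Finset.mem_filter.1 (hτ p)).1 j
    have htr : ∀ p, Transverse (pts p) (τ p) := fun p => (Finset.mem_filter.1 (hτ p)).2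
    have h1 := one_le_factorial_mul_sum hsum (τ := τ) htr (M := M) (u := u)
      (fun p j => (hMu j _ (hmem p j)).1)
      (fun p j q hq => (hMu j _ (hmem p j)).2 p q ((htr p).1 j) hq) hI (m := m) (R := R) (a := a)
      (fun p _ => by have := haA p; omega) hgap
    have h2 : ∑ p ∈ I, Φ a p ≤ c + N * ε := by
      calc ∑ p ∈ I, Φ a p ≤ ∑ p ∈ I, (c * w p + ε) := Finset.sum_le_sum hlt
        _ ≤ ∑ p, (c * w p + ε) := Finset.sum_le_sum_of_subset_of_nonneg (Finset.subset_univ _)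
            fun p _ _ => add_nonneg (mul_nonneg hcpos.le (hw p)) (by positivity)
        _ = c + N * ε := by
          rw [Finset.sum_add_distrib, ← Finset.mul_sum, hw1]
          simp
    have h3 : (1 : ℝ) ≤ n.factorial * ∑ p ∈ I, Φ a p := by
      rw [Finset.sum_congr rfl fun p _ => hτΦ p]
      exact h1
    have h4 : n.factorial * (2 * c) = 1 := by
      rw [hc]
      field_simp
    nlinarith

end Weights

end Multijoint

namespace Multijoint

section Summation

lemma sum_prod_rpow_le {α ι : Type*} [Fintype ι] [Nonempty ι] (s : Finset α) {h : ι → α → ℝ}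
    {H : ι → ℝ} (hh : ∀ j, ∀ p ∈ s, 0 ≤ h j p) (hH : ∀ j, ∑ p ∈ s, h j p ≤ H j) :
    ∑ p ∈ s, (∏ j, h j p) ^ ((Fintype.card ι : ℝ)⁻¹) ≤ (∏ j, H j) ^ ((Fintype.card ι : ℝ)⁻¹) := by
  have hd : (0 : ℝ) < Fintype.card ι := by exact_mod_cast Fintype.card_pos
  have hH0 : ∀ j, 0 ≤ H j := fun j => (Finset.sum_nonneg (hh j)).trans (hH j)
  by_cases hz : ∃ j, H j = 0
  · obtain ⟨j, hj⟩ := hz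
    refine le_trans (le_of_eq (Finset.sum_eq_zero fun p hp => ?_))
      (Real.rpow_nonneg (Finset.prod_nonneg fun i _ => hH0 i) _)
    have h0 : h j p = 0 := le_antisymm
      ((Finset.single_le_sum (hh j) hp).trans ((hH j).trans_eq hj)) (hh j p hp)
    rw [Finset.prod_eq_zero (Finset.mem_univ j) h0, Real.zero_rpow (by positivity)]
  · push Not at hz
    have hHpos : ∀ j, 0 < H j := fun j => (hH0 j).lt_of_ne' (hz j)
    have key : ∀ p ∈ s, (∏ j, h j p) ^ ((Fintype.card ι : ℝ)⁻¹) ≤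
        (∏ j, H j) ^ ((Fintype.card ι : ℝ)⁻¹) *
          ∑ j, (Fintype.card ι : ℝ)⁻¹ * (h j p / H j) := by
      intro p hp
      have h1 := Real.geom_mean_le_arith_mean_weighted Finset.univ
        (fun _ : ι => (Fintype.card ι : ℝ)⁻¹) (fun j => h j p / H j)
        (fun _ _ => by positivity) (by simp) (fun j _ => div_nonneg (hh j p hp) (hH0 j))
      rw [Real.finsetProd_rpow _ _ (fun j _ => div_nonneg (hh j p hp) (hH0 j))] at h1
      have h2 : ∏ j, h j p = (∏ j, H j) * ∏ j, h j p / H j := by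
        rw [← Finset.prod_mul_distrib]
        exact Finset.prod_congr rfl fun j _ => (mul_div_cancel₀ _ (hz j)).symm
      rw [h2, Real.mul_rpow (Finset.prod_nonneg fun i _ => hH0 i)
        (Finset.prod_nonneg fun j _ => div_nonneg (hh j p hp) (hH0 j))]
      exact mul_le_mul_of_nonneg_left h1 (Real.rpow_nonneg (Finset.prod_nonneg fun i _ => hH0 i) _)
    refine (Finset.sum_le_sum key).trans ?_
    rw [← Finset.mul_sum, Finset.sum_comm]
    refine mul_le_of_le_one_right (Real.rpow_nonneg (Finset.prod_nonneg fun i _ => hH0 i) _) ?_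
    calc ∑ j, ∑ p ∈ s, (Fintype.card ι : ℝ)⁻¹ * (h j p / H j)
        ≤ ∑ _j : ι, (Fintype.card ι : ℝ)⁻¹ := Finset.sum_le_sum fun j _ => by
          rw [← Finset.mul_sum, ← Finset.sum_div]
          exact mul_le_of_le_one_right (by positivity) ((div_le_one (hHpos j)).2 (hH j))
      _ = 1 := by simp

lemma le_of_weighted_bound {D c Z A : ℝ} (hD : 2 ≤ D) (hc : 0 < c) (hc1 : c ≤ 1) (hZ : 0 < Z)
    (hA : 0 ≤ A) (h : (c / Z) ^ D⁻¹ * Z ≤ A ^ D⁻¹) : Z ≤ c⁻¹ * A ^ (D - 1)⁻¹ := by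
  have h1 : c * Z ^ (D - 1) ≤ A := by
    have h2 := Real.rpow_le_rpow (by positivity) h (show 0 ≤ D by linarith)
    rw [Real.mul_rpow (by positivity) hZ.le, Real.rpow_inv_rpow (by positivity) (by linarith),
      Real.rpow_inv_rpow hA (by linarith)] at h2
    rwa [Real.rpow_sub_one hZ.ne', ← mul_div_assoc, ← div_mul_eq_mul_div]
  have h3 : Z ^ (D - 1) ≤ c⁻¹ * A := by
    rw [inv_mul_eq_div, le_div_iff₀ hc]
    linarith
  have h4 := Real.rpow_le_rpow (by positivity) h3 (show 0 ≤ (D - 1)⁻¹ from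
    inv_nonneg.2 (by linarith))
  rw [Real.rpow_rpow_inv hZ.le (by linarith), Real.mul_rpow (by positivity) hA] at h4
  refine h4.trans (mul_le_mul_of_nonneg_right ?_ (Real.rpow_nonneg hA _))
  exact Real.rpow_le_self_of_one_le (one_le_inv_iff₀.2 ⟨hc, hc1⟩)
    (inv_le_one_of_one_le₀ (by linarith))

lemma sum_multijoint_le {F : Type} [Field F] {n d N : ℕ} {k : Fin d → ℕ} (hd : 2 ≤ d)
    (hk : ∀ j, 0 < k j) (hsum : ∑ j, k j = n)
    (P : (j : Fin d) → Finset (AffineSubspace F (Fin n → F)))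
    (hP : ∀ j, ∀ π ∈ P j, (π : Set (Fin n → F)).Nonempty ∧ Module.finrank F π.direction = k j)
    {f : (j : Fin d) → AffineSubspace F (Fin n → F) → ℝ} (hf : ∀ j π, 0 ≤ f j π)
    {pts : Fin N → Fin n → F} (hpts : Function.Injective pts)
    (hne : ∀ p, ∑ π ∈ Fintype.piFinset P, mjDelta (pts p) π * ∏ j, f j (π j) ≠ 0) :
    ∑ p, (∑ π ∈ Fintype.piFinset P, mjDelta (pts p) π * ∏ j, f j (π j)) ^ (((d : ℝ) - 1)⁻¹) ≤
      2 * n.factorial * ∏ j, (∑ π ∈ P j, f j π) ^ (((d : ℝ) - 1)⁻¹) := by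
  classical
  have : Nonempty (Fin d) := ⟨⟨0, by omega⟩⟩
  have hD : (2 : ℝ) ≤ d := by exact_mod_cast hd
  have hH0 : ∀ j, 0 ≤ ∑ π ∈ P j, f j π := fun j => Finset.sum_nonneg fun π _ => hf j π
  have hδ : ∀ (x : Fin n → F) (π : Fin d → AffineSubspace F (Fin n → F)),
      mjDelta x π = if Transverse x π then 1 else 0 := by
    intro x π
    by_cases h : Transverse x π
    · rw [if_pos h]; exact if_pos h
    · rw [if_neg h]; exact if_neg h
  set G : Fin N → ℝ := fun p =>
    ∑ π ∈ Fintype.piFinset P, mjDelta (pts p) π * ∏ j, f j (π j) with hG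
  have hGpos : ∀ p, 0 < G p := fun p => (Finset.sum_nonneg fun π _ => mul_nonneg
    (by rw [hδ]; split_ifs <;> norm_num) (Finset.prod_nonneg fun j _ => hf j _)).lt_of_ne' (hne p)
  rcases isEmpty_or_nonempty (Fin N) with hN | hN
  · rw [Finset.univ_eq_empty, Finset.sum_empty]
    exact mul_nonneg (by positivity) (Finset.prod_nonneg fun j _ => Real.rpow_nonneg (hH0 j) _)
  set s : ℝ := ((d : ℝ) - 1)⁻¹ with hs
  set Z : ℝ := ∑ p, G p ^ s with hZ
  have hZpos : 0 < Z := Finset.sum_pos (fun p _ => Real.rpow_pos_of_pos (hGpos p) _)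
    Finset.univ_nonempty
  set c : ℝ := (2 * n.factorial : ℝ)⁻¹ with hc
  have hfac : (1 : ℝ) ≤ n.factorial := by exact_mod_cast n.factorial_pos
  have hcpos : 0 < c := by positivity
  obtain ⟨β, hβ0, hβ1, hβ⟩ := exists_weights hk hsum P hP hpts (w := fun p => G p ^ s / Z)
    (fun p => div_nonneg (Real.rpow_nonneg (hGpos p).le _) hZpos.le)
    (by rw [← Finset.sum_div, div_self hZpos.ne']) (fun p => by
      obtain ⟨τ, hτ, h⟩ := Finset.exists_ne_zero_of_sum_ne_zero (hne p)
      refine ⟨τ, hτ, ?_⟩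
      by_contra h'
      rw [hδ, if_neg h', zero_mul] at h
      exact h rfl)
  have hHolder := sum_prod_rpow_le (Finset.univ : Finset (Fin N))
    (h := fun j p => ∑ π ∈ P j, β j π p * f j π) (H := fun j => ∑ π ∈ P j, f j π)
    (fun j p _ => Finset.sum_nonneg fun π _ => mul_nonneg (hβ0 j π p) (hf j π)) (fun j => by
      rw [Finset.sum_comm]
      refine Finset.sum_le_sum fun π _ => ?_
      rw [← Finset.sum_mul]
      exact mul_le_of_le_one_left (hf j π) (hβ1 j π))
  rw [Fintype.card_fin] at hHolder
  have hpoint : ∀ p, (c / Z) ^ ((d : ℝ)⁻¹) * G p ^ s ≤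
      (∏ j, ∑ π ∈ P j, β j π p * f j π) ^ ((d : ℝ)⁻¹) := by
    intro p
    have h1 : c / Z * G p ^ (s * d) ≤ ∏ j, ∑ π ∈ P j, β j π p * f j π := by
      have h2 : c / Z * G p ^ (s * d) = c * (G p ^ s / Z) * G p := by
        rw [show s * d = s + 1 by rw [hs]; field_simp [show (d : ℝ) - 1 ≠ 0 by linarith]; ring,
          Real.rpow_add_one (hGpos p).ne']
        ring
      rw [h2, Finset.prod_univ_sum, hG, Finset.mul_sum]
      refine Finset.sum_le_sum fun τ hτ => ?_
      rw [hδ, Finset.prod_mul_distrib]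
      have hf0 : 0 ≤ ∏ j, f j (τ j) := Finset.prod_nonneg fun j _ => hf j _
      split_ifs with h
      · rw [one_mul]
        exact mul_le_mul_of_nonneg_right (hβ p τ hτ h) hf0
      · rw [zero_mul, mul_zero]
        exact mul_nonneg (Finset.prod_nonneg fun j _ => hβ0 _ _ _) hf0
    have h3 := Real.rpow_le_rpow (mul_nonneg (by positivity) (Real.rpow_nonneg (hGpos p).le _)) h1
      (show (0 : ℝ) ≤ (d : ℝ)⁻¹ by positivity)
    rwa [Real.mul_rpow (by positivity) (Real.rpow_nonneg (hGpos p).le _),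
      ← Real.rpow_mul (hGpos p).le, mul_assoc, mul_inv_cancel₀ (by linarith), mul_one] at h3
  have hfinal := le_of_weighted_bound hD hcpos (inv_le_one_of_one_le₀ (by linarith)) hZpos
    (Finset.prod_nonneg fun j _ => hH0 j) (by
      refine le_trans ?_ hHolder
      rw [hZ, Finset.mul_sum]
      exact Finset.sum_le_sum fun p _ => hpoint p)
  rwa [hc, inv_inv, ← Real.finsetProd_rpow _ _ fun j _ => hH0 j] at hfinal

end Summation

end Multijoint

/-- **Multijoint inequality for `k_j`-planes.**
Let `d ≥ 2`, `n`, `k 0, …, k (d-1)` be positive integers with `∑ j, k j = n`, `F` a field, and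
`P j` finite sets of affine `k j`-planes in `Fⁿ`. There is a constant `C = C(n)` such that for
all `f j : P j → ℝ≥0`,
`∑ p, (∑ π₁ ∈ P 0, …, ∑ π_d ∈ P (d-1), δ(p, π) * ∏ j, f j (π j)) ^ (1/(d-1))
  ≤ C * ∏ j, (∑ π ∈ P j, f j π) ^ (1/(d-1))`. -/
theorem multijoint_inequality_planes (n : ℕ) (hn : 0 < n) :
    ∃ C : ℝ, 0 < C ∧
      ∀ (d : ℕ) (k : Fin d → ℕ), 2 ≤ d → (∀ j, 0 < k j) → (∑ j, k j) = n →
      ∀ (F : Type) [Field F]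
        (P : (j : Fin d) → Finset (AffineSubspace F (Fin n → F))),
        (∀ j, ∀ π ∈ P j,
          (π : Set (Fin n → F)).Nonempty ∧ Module.finrank F π.direction = k j) →
        ∀ f : (j : Fin d) → AffineSubspace F (Fin n → F) → ℝ,
          (∀ j π, 0 ≤ f j π) →
          (∑ᶠ p : Fin n → F,
              (∑ π ∈ Fintype.piFinset P, mjDelta p π * ∏ j, f j (π j))
                ^ (((d : ℝ) - 1)⁻¹))
            ≤ C * ∏ j, (∑ π ∈ P j, f j π) ^ (((d : ℝ) - 1)⁻¹) := by
  refine ⟨2 * n.factorial, by positivity, fun d k hd hk hsum F _ P hP f hf => ?_⟩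
  have hs : ((d : ℝ) - 1)⁻¹ ≠ 0 := by
    have : (2 : ℝ) ≤ d := by exact_mod_cast hd
    exact inv_ne_zero (by linarith)
  set g : (Fin n → F) → ℝ := fun p =>
    (∑ π ∈ Fintype.piFinset P, mjDelta p π * ∏ j, f j (π j)) ^ (((d : ℝ) - 1)⁻¹) with hg
  by_cases hfin : (Function.support g).Finite
  · rw [finsum_eq_sum g hfin, ← Finset.sum_coe_sort,
      ← Equiv.sum_comp hfin.toFinset.equivFin.symm]
    refine Multijoint.sum_multijoint_le hd hk hsum P hP hf
      (pts := fun i => (hfin.toFinset.equivFin.symm i : Fin n → F))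
      (Subtype.val_injective.comp (Equiv.injective _)) fun i h => ?_
    refine hfin.mem_toFinset.1 (hfin.toFinset.equivFin.symm i).2 ?_
    exact (congrArg (· ^ (((d : ℝ) - 1)⁻¹)) h).trans (Real.zero_rpow hs)
  · rw [finsum_of_infinite_support hfin]
    exact mul_nonneg (by positivity) (Finset.prod_nonneg fun j _ =>
      Real.rpow_nonneg (Finset.sum_nonneg fun π _ => hf j π) _)
end
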